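/- Let {Φ_n}_{n∈ℕ} be a sequence of quantum operations from A to B with dual maps {Φ_n*}. The following are equivalent: (i) {Φ_n} has a limit point in F_{≤1}(A,B) with respect to the strong convergence topology; (ii) there is a faithful state σ ∈ S(H_A) such that {Φ_n(σ)} has a limit point in T_+(H_B) in trace norm; (iii) there exist a faithful state σ ∈ S(H_A), a strictly increasing sequence {n_k} of natural numbers, and an increasing sequence {P_m} of finite-rank projections on H_B converging strongly to I_B such that lim_{m→∞} sup_k Tr((I_B − P_m)Φ_{n_k}(σ)) = 0; (iv) there exist an increasing sequence {P_m} of finite-rank projections on H_B converging strongly to I_B, a strictly increasing sequence {n_k}, and positive operators A_m ∈ B(H_A) such that Φ_{n_k}*(P_m) → A_m in the weak operator topology for every m and Φ_{n_k}*(I_B) → sup_m A_m in the weak operator topology, where sup_m A_m is the least upper bound of the nondecreasing sequence {A_m}; (v) there exist a faithful state σ ∈ S(H_A), an increasing sequence {P_m} of finite-rank projections converging strongly to I_B, and a strictly increasing sequence {n_k} such that lim_k Tr(Φ_{n_k}*(P_m)σ) = a_m ∈ ℝ₊ for every m and lim_k Tr(Φ_{n_k}*(I_B)σ) = sup_m a_m.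 If all Φ_n are quantum channels, then in (i) and (ii) the limit points are channels and states respectively, and the second conditions in (iv) and (v) read sup_m A_m = I_A and sup_m a_m = 1. -/

import Mathlib

open Filter Topology ContinuousLinearMap
open scoped ComplexOrder

noncomputable section

notation "⟪" x ", " y "⟫" => @inner ℂ _ _ x y

section Defs

variable {H K : Type*} [NormedAddCommGroup H] [InnerProductSpace ℂ H] [CompleteSpace H]
  [NormedAddCommGroup K] [InnerProductSpace ℂ K] [CompleteSpace K]

/-- The rank-one operator `|y⟩⟨z|`. -/
def rankOne (y : K) (z : H) : H →L[ℂ] K :=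
  (ContinuousLinearMap.toSpanSingleton ℂ y).comp (innerSL ℂ z)

/-- `A` is a trace-class operator (equivalently, nuclear operator). -/
def IsTC (A : H →L[ℂ] K) : Prop :=
  ∃ f : ℕ → K, ∃ g : ℕ → H, Summable (fun n => ‖f n‖ * ‖g n‖) ∧
    ∀ x : H, HasSum (fun n => ⟪g n, x⟫ • f n) (A x)

/-- The trace of an operator, computed in a Hilbert basis. -/
def trC {ι : Type*} (e : HilbertBasis ι ℂ H) (A : H →L[ℂ] H) : ℂ :=
  ∑' i, ⟪e i, A (e i)⟫

/-- The trace norm `‖A‖₁ = sup {|Tr (B A)| : ‖B‖ ≤ 1}`. -/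
def tnorm {ι : Type*} (e : HilbertBasis ι ℂ H) (A : H →L[ℂ] H) : ℝ :=
  sSup { r : ℝ | ∃ B : H →L[ℂ] H, ‖B‖ ≤ 1 ∧ r = ‖trC e (B ∘L A)‖ }

/-- Membership in the positive cone `T₊(H)` of trace-class operators. -/
def IsPTC (ρ : H →L[ℂ] H) : Prop := ρ.IsPositive ∧ IsTC ρ

/-- `ρ` is a state (a positive trace-class operator of unit trace). -/
def IsState {ι : Type*} (e : HilbertBasis ι ℂ H) (ρ : H →L[ℂ] H) : Prop :=
  ρ.IsPositive ∧ IsTC ρ ∧ trC e ρ = 1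

/-- `ρ` is a faithful state (a state with trivial kernel). -/
def IsFaithfulState {ι : Type*} (e : HilbertBasis ι ℂ H) (ρ : H →L[ℂ] H) : Prop :=
  IsState e ρ ∧ ∀ x, ρ x = 0 → x = 0

/-- The Loewner operator order. -/
def OpLE (A B : H →L[ℂ] H) : Prop := (B - A).IsPositive

/-- `S` is the least upper bound of the sequence `A` in the Loewner order. -/
def IsLUBOp (A : ℕ → H →L[ℂ] H) (S : H →L[ℂ] H) : Prop :=
  (∀ m, OpLE (A m) S) ∧ ∀ C, (∀ m, OpLE (A m) C) → OpLE S C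

/-- A quantum operation from `A` to `B`: a completely positive trace-non-increasing
linear map from `T(H_A)` to `T(H_B)`. -/
structure QOp (eA : HilbertBasis ℕ ℂ H) (eB : HilbertBasis ℕ ℂ K) where
  toFun : (H →L[ℂ] H) → (K →L[ℂ] K)
  map_add' : ∀ ρ σ : H →L[ℂ] H, IsTC ρ → IsTC σ → toFun (ρ + σ) = toFun ρ + toFun σ
  map_smul' : ∀ (c : ℂ) (ρ : H →L[ℂ] H), IsTC ρ → toFun (c • ρ) = c • toFun ρ
  maps_tc' : ∀ ρ : H →L[ℂ] H, IsTC ρ → IsTC (toFun ρ)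
  completely_pos' : ∀ (n : ℕ) (y : Fin n → H) (x : Fin n → K),
    0 ≤ ∑ i, ∑ j, ⟪x i, toFun (rankOne (y i) (y j)) (x j)⟫
  trace_nonincreasing' : ∀ ρ : H →L[ℂ] H, ρ.IsPositive → IsTC ρ →
    (trC eB (toFun ρ)).re ≤ (trC eA ρ).re

variable {eA : HilbertBasis ℕ ℂ H} {eB : HilbertBasis ℕ ℂ K}

/-- A quantum channel is a trace-preserving quantum operation. -/
def IsChannel (Φ : QOp eA eB) : Prop :=
  ∀ ρ : H →L[ℂ] H, ρ.IsPositive → IsTC ρ → trC eB (Φ.toFun ρ) = trC eA ρ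

/-- Convergence in the trace norm. -/
def TNConv {ι : Type*} (e : HilbertBasis ι ℂ K) (a : ℕ → K →L[ℂ] K) (L : K →L[ℂ] K) : Prop :=
  Tendsto (fun n => tnorm e (a n - L)) atTop (nhds 0)

/-- Strong convergence of a sequence of quantum operations. -/
def StrongConv (Φn : ℕ → QOp eA eB) (Φ : QOp eA eB) : Prop :=
  ∀ ρ : H →L[ℂ] H, IsState eA ρ → TNConv eB (fun n => (Φn n).toFun ρ) (Φ.toFun ρ)

/-- Relative (sequential) compactness in the strong convergence topology. -/
def QRelCompact (F : Set (QOp eA eB)) : Prop :=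
  ∀ Φs : ℕ → QOp eA eB, (∀ n, Φs n ∈ F) →
    ∃ (k : ℕ → ℕ) (Φ₀ : QOp eA eB), StrictMono k ∧ StrongConv (fun n => Φs (k n)) Φ₀

/-- Relative (sequential) compactness within the set of quantum channels. -/
def QRelCompactCh (F : Set (QOp eA eB)) : Prop :=
  ∀ Φs : ℕ → QOp eA eB, (∀ n, Φs n ∈ F) →
    ∃ (k : ℕ → ℕ) (Φ₀ : QOp eA eB), StrictMono k ∧ IsChannel Φ₀ ∧
      StrongConv (fun n => Φs (k n)) Φ₀

/-- (Sequential) compactness in the strong convergence topology. -/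
def QSeqCompact (F : Set (QOp eA eB)) : Prop :=
  ∀ Φs : ℕ → QOp eA eB, (∀ n, Φs n ∈ F) →
    ∃ (k : ℕ → ℕ) (Φ₀ : QOp eA eB), StrictMono k ∧ Φ₀ ∈ F ∧
      StrongConv (fun n => Φs (k n)) Φ₀

/-- (Sequential) closedness in the strong convergence topology. -/
def QSeqClosed (F : Set (QOp eA eB)) : Prop :=
  ∀ (Φs : ℕ → QOp eA eB) (Φ₀ : QOp eA eB), (∀ n, Φs n ∈ F) → StrongConv Φs Φ₀ → Φ₀ ∈ F

/-- (Sequential) compactness of a set of operators in the trace norm. -/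
def TNSeqCompact {ι : Type*} (e : HilbertBasis ι ℂ K) (S : Set (K →L[ℂ] K)) : Prop :=
  ∀ a : ℕ → K →L[ℂ] K, (∀ n, a n ∈ S) →
    ∃ (k : ℕ → ℕ) (L : K →L[ℂ] K), StrictMono k ∧ L ∈ S ∧ TNConv e (fun n => a (k n)) L

/-- Relative (sequential) compactness of `S` within the ambient set `T`, in the trace norm. -/
def TNRelCompactIn {ι : Type*} (e : HilbertBasis ι ℂ K) (T S : Set (K →L[ℂ] K)) : Prop :=
  ∀ a : ℕ → K →L[ℂ] K, (∀ n, a n ∈ S) →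
    ∃ (k : ℕ → ℕ) (L : K →L[ℂ] K), StrictMono k ∧ L ∈ T ∧ TNConv e (fun n => a (k n)) L

/-- `A` is a Kraus representation of `Φ`. -/
def KrausRep (Φ : QOp eA eB) (A : ℕ → H →L[ℂ] K) : Prop :=
  ∀ ρ : H →L[ℂ] H, IsTC ρ →
    HasSum (fun n => A n ∘L ρ ∘L (ContinuousLinearMap.adjoint (A n))) (Φ.toFun ρ)

/-- The Choi rank of a quantum operation: the minimal number of Kraus operators. -/
def ChoiRank (Φ : QOp eA eB) : ℕ∞ :=
  sInf { n : ℕ∞ | ∃ A : ℕ → H →L[ℂ] K, (∀ i : ℕ, n ≤ (i : ℕ∞) → A i = 0) ∧ KrausRep Φ A }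

/-- Convergence in the strong operator topology. -/
def SOTConv (a : ℕ → H →L[ℂ] K) (A : H →L[ℂ] K) : Prop :=
  ∀ x : H, Tendsto (fun n => a n x) atTop (nhds (A x))

/-- Relative (sequential) compactness in the strong operator topology. -/
def SOTRelCompact (S : Set (H →L[ℂ] K)) : Prop :=
  ∀ a : ℕ → H →L[ℂ] K, (∀ n, a n ∈ S) →
    ∃ (k : ℕ → ℕ) (A : H →L[ℂ] K), StrictMono k ∧ SOTConv (fun n => a (k n)) A

/-- (Sequential) compactness in the strong operator topology. -/
def SOTSeqCompact (S : Set (H →L[ℂ] K)) : Prop :=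
  ∀ a : ℕ → H →L[ℂ] K, (∀ n, a n ∈ S) →
    ∃ (k : ℕ → ℕ) (A : H →L[ℂ] K), StrictMono k ∧ A ∈ S ∧ SOTConv (fun n => a (k n)) A

/-- A finite-rank orthogonal projection. -/
def IsFinRankProj (P : K →L[ℂ] K) : Prop :=
  IsSelfAdjoint P ∧ P ∘L P = P ∧ FiniteDimensional ℂ (LinearMap.range (P : K →ₗ[ℂ] K))

end Defs

section Tensor

variable {H K W : Type*} [NormedAddCommGroup H] [InnerProductSpace ℂ H] [CompleteSpace H]
  [NormedAddCommGroup K] [InnerProductSpace ℂ K] [CompleteSpace K]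
  [NormedAddCommGroup W] [InnerProductSpace ℂ W] [CompleteSpace W]

/-- A realization of `W` as the Hilbert tensor product `H ⊗ K`. -/
structure TensorStruct (H K W : Type*) [NormedAddCommGroup H] [InnerProductSpace ℂ H]
    [NormedAddCommGroup K] [InnerProductSpace ℂ K]
    [NormedAddCommGroup W] [InnerProductSpace ℂ W] where
  mul : H → K → W
  inner_mul : ∀ (x x' : H) (y y' : K), ⟪mul x y, mul x' y'⟫ = ⟪x, x'⟫ * ⟪y, y'⟫
  dense_span : Dense (↑(Submodule.span ℂ {w : W | ∃ x y, w = mul x y}) : Set W)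

/-- `Z = X ⊗ Y` relative to the tensor realization `T`. -/
def IsTensorOp (T : TensorStruct H K W) (X : H →L[ℂ] H) (Y : K →L[ℂ] K)
    (Z : W →L[ℂ] W) : Prop :=
  ∀ x y, Z (T.mul x y) = T.mul (X x) (Y y)

/-- `b = Tr_K ω`, the left partial trace, characterized by duality. -/
def IsLeftMarginal (T : TensorStruct H K W) {ι κ : Type*} (eH : HilbertBasis ι ℂ H)
    (eW : HilbertBasis κ ℂ W) (ω : W →L[ℂ] W) (b : H →L[ℂ] H) : Prop :=
  ∀ (X : H →L[ℂ] H) (Z : W →L[ℂ] W), IsTensorOp T X 1 Z →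
    trC eH (b ∘L X) = trC eW (ω ∘L Z)

/-- `c = Tr_H ω`, the right partial trace, characterized by duality. -/
def IsRightMarginal (T : TensorStruct H K W) {ι κ : Type*} (eK : HilbertBasis ι ℂ K)
    (eW : HilbertBasis κ ℂ W) (ω : W →L[ℂ] W) (c : K →L[ℂ] K) : Prop :=
  ∀ (Y : K →L[ℂ] K) (Z : W →L[ℂ] W), IsTensorOp T 1 Y Z →
    trC eK (c ∘L Y) = trC eW (ω ∘L Z)

end Tensor

section Statement

variable {HA HB : Type*} [NormedAddCommGroup HA] [InnerProductSpace ℂ HA] [CompleteSpace HA]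
  [NormedAddCommGroup HB] [InnerProductSpace ℂ HB] [CompleteSpace HB]

/-- An increasing sequence of finite-rank projections converging strongly to the identity. -/
def ProjSeq (P : ℕ → HB →L[ℂ] HB) : Prop :=
  (∀ m, IsFinRankProj (P m)) ∧ (∀ m, P (m + 1) ∘L P m = P m) ∧
    ∀ x : HB, Tendsto (fun m => P m x) atTop (nhds x)

variable (eA : HilbertBasis ℕ ℂ HA) (eB : HilbertBasis ℕ ℂ HB)

/-- (i): the sequence has a limit point in `F_{≤1}(A,B)`. -/
def HasLimitPoint (Φn : ℕ → QOp eA eB) : Prop :=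
  ∃ (k : ℕ → ℕ) (Φ₀ : QOp eA eB), StrictMono k ∧ StrongConv (fun j => Φn (k j)) Φ₀

/-- (ii): for some faithful state `σ` the sequence `{Φ_n(σ)}` has a limit point in `T₊(H_B)`. -/
def HasImageLimitPoint (Φn : ℕ → QOp eA eB) : Prop :=
  ∃ σ : HA →L[ℂ] HA, IsFaithfulState eA σ ∧
    ∃ (k : ℕ → ℕ) (L : HB →L[ℂ] HB), StrictMono k ∧ IsPTC L ∧
      TNConv eB (fun j => (Φn (k j)).toFun σ) L

/-- (iii): a uniform tail-vanishing condition along a subsequence. -/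
def TailCondition (Φn : ℕ → QOp eA eB) : Prop :=
  ∃ σ : HA →L[ℂ] HA, IsFaithfulState eA σ ∧
    ∃ k : ℕ → ℕ, StrictMono k ∧
      ∃ P : ℕ → HB →L[ℂ] HB, ProjSeq P ∧
        Tendsto (fun m => ⨆ j,
            (trC eB ((((1 : HB →L[ℂ] HB) - P m)) ∘L (Φn (k j)).toFun σ)).re)
          atTop (nhds 0)

/-- (iv): weak-operator convergence of the dual maps on an increasing sequence of finite-rank
projections, compatible with the least upper bound. -/
def DualWOTCondition (Φd : ℕ → (HB →L[ℂ] HB) → (HA →L[ℂ] HA)) : Prop :=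
  ∃ P : ℕ → HB →L[ℂ] HB, ProjSeq P ∧
    ∃ k : ℕ → ℕ, StrictMono k ∧
      ∃ A : ℕ → HA →L[ℂ] HA, (∀ m, (A m).IsPositive) ∧
        (∀ (m : ℕ) (x y : HA),
          Tendsto (fun j => ⟪x, Φd (k j) (P m) y⟫) atTop (nhds ⟪x, A m y⟫)) ∧
        ∃ S : HA →L[ℂ] HA, IsLUBOp A S ∧
          ∀ x y : HA, Tendsto (fun j => ⟪x, Φd (k j) 1 y⟫) atTop (nhds ⟪x, S y⟫)

/-- (v): the scalar version of (iv) w.r.t. a faithful state `σ`. -/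
def DualScalarCondition (Φd : ℕ → (HB →L[ℂ] HB) → (HA →L[ℂ] HA)) : Prop :=
  ∃ σ : HA →L[ℂ] HA, IsFaithfulState eA σ ∧
    ∃ P : ℕ → HB →L[ℂ] HB, ProjSeq P ∧
      ∃ k : ℕ → ℕ, StrictMono k ∧
        ∃ a : ℕ → ℝ, (∀ m, 0 ≤ a m) ∧
          (∀ m, Tendsto (fun j => (trC eA (Φd (k j) (P m) ∘L σ)).re) atTop (nhds (a m))) ∧
          Tendsto (fun j => (trC eA (Φd (k j) 1 ∘L σ)).re) atTop (nhds (⨆ m, a m))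

/-- (i) for channels: a limit point which is a channel. -/
def HasLimitPointCh (Φn : ℕ → QOp eA eB) : Prop :=
  ∃ (k : ℕ → ℕ) (Φ₀ : QOp eA eB), StrictMono k ∧ IsChannel Φ₀ ∧
    StrongConv (fun j => Φn (k j)) Φ₀

/-- (ii) for channels: a limit point of `{Φ_n(σ)}` which is a state. -/
def HasImageLimitPointCh (Φn : ℕ → QOp eA eB) : Prop :=
  ∃ σ : HA →L[ℂ] HA, IsFaithfulState eA σ ∧
    ∃ (k : ℕ → ℕ) (L : HB →L[ℂ] HB), StrictMono k ∧ IsState eB L ∧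
      TNConv eB (fun j => (Φn (k j)).toFun σ) L

/-- (iv) for channels: `sup_m A_m = I_A`. -/
def DualWOTConditionCh (Φd : ℕ → (HB →L[ℂ] HB) → (HA →L[ℂ] HA)) : Prop :=
  ∃ P : ℕ → HB →L[ℂ] HB, ProjSeq P ∧
    ∃ k : ℕ → ℕ, StrictMono k ∧
      ∃ A : ℕ → HA →L[ℂ] HA, (∀ m, (A m).IsPositive) ∧
        (∀ (m : ℕ) (x y : HA),
          Tendsto (fun j => ⟪x, Φd (k j) (P m) y⟫) atTop (nhds ⟪x, A m y⟫)) ∧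
        IsLUBOp A 1

/-- (v) for channels: `sup_m a_m = 1`. -/
def DualScalarConditionCh (Φd : ℕ → (HB →L[ℂ] HB) → (HA →L[ℂ] HA)) : Prop :=
  ∃ σ : HA →L[ℂ] HA, IsFaithfulState eA σ ∧
    ∃ P : ℕ → HB →L[ℂ] HB, ProjSeq P ∧
      ∃ k : ℕ → ℕ, StrictMono k ∧
        ∃ a : ℕ → ℝ, (∀ m, 0 ≤ a m) ∧
          (∀ m, Tendsto (fun j => (trC eA (Φd (k j) (P m) ∘L σ)).re) atTop (nhds (a m))) ∧
          (⨆ m, a m) = 1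

section TraceClass

variable {H K : Type*} [NormedAddCommGroup H] [InnerProductSpace ℂ H]
  [NormedAddCommGroup K] [InnerProductSpace ℂ K]
  {ι : Type*} (e : HilbertBasis ι ℂ H)

/-- A representation `T = ∑ₙ |fₙ⟩⟨gₙ|` with square-summable `f` and `g`. -/
def HSRep (f : ℕ → K) (g : ℕ → H) (T : H →L[ℂ] K) : Prop :=
  Summable (fun n => ‖f n‖ ^ 2) ∧ Summable (fun n => ‖g n‖ ^ 2) ∧
    ∀ x, HasSum (fun n => ⟪g n, x⟫ • f n) (T x)

lemma exists_balanced (f : K) (g : H) : ∃ f' : K, ∃ g' : H,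
    ‖f'‖ ^ 2 ≤ ‖f‖ * ‖g‖ ∧ ‖g'‖ ^ 2 ≤ ‖f‖ * ‖g‖ ∧ ∀ x, ⟪g', x⟫ • f' = ⟪g, x⟫ • f := by
  by_cases h : f = 0 ∨ g = 0
  · refine ⟨0, 0, by simp; positivity, by simp; positivity, fun x => ?_⟩
    rcases h with h | h <;> simp [h]
  · push Not at h
    have hf : 0 < ‖f‖ := norm_pos_iff.2 h.1
    have hg : 0 < ‖g‖ := norm_pos_iff.2 h.2
    set r : ℝ := Real.sqrt (‖g‖ / ‖f‖) with hr
    have hr0 : 0 < r := Real.sqrt_pos.2 (by positivity)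
    have hr2 : r ^ 2 = ‖g‖ / ‖f‖ := Real.sq_sqrt (by positivity)
    refine ⟨(r : ℂ) • f, ((r⁻¹ : ℝ) : ℂ) • g, ?_, ?_, fun x => ?_⟩
    · rw [norm_smul, mul_pow, Complex.norm_real, Real.norm_eq_abs, sq_abs, hr2]
      apply le_of_eq; field_simp
    · rw [norm_smul, mul_pow, Complex.norm_real, Real.norm_eq_abs, sq_abs, inv_pow, hr2]
      apply le_of_eq; field_simp
    · rw [inner_smul_left, smul_smul, Complex.conj_ofReal]
      congr 1
      have : (r : ℂ) ≠ 0 := by exact_mod_cast hr0.ne'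
      push_cast
      field_simp

lemma IsTC.exists_rep {T : H →L[ℂ] K} (hT : IsTC T) : ∃ f g, HSRep f g T := by
  obtain ⟨f, g, hs, h⟩ := hT
  choose f' g' h1 h2 h3 using fun n => exists_balanced (f n) (g n)
  refine ⟨f', g', .of_nonneg_of_le (fun n => by positivity) h1 hs,
    .of_nonneg_of_le (fun n => by positivity) h2 hs, fun x => ?_⟩
  simpa only [h3] using h x

namespace HSRep

variable {f : ℕ → K} {g : ℕ → H} {T : H →L[ℂ] K}

lemma summable_mul (h : HSRep f g T) : Summable (fun n => ‖f n‖ * ‖g n‖) :=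
  .of_nonneg_of_le (fun n => by positivity)
    (fun n => by nlinarith [sq_nonneg (‖f n‖ - ‖g n‖), sq_nonneg ‖f n‖, sq_nonneg ‖g n‖])
    (h.1.add h.2.1)

lemma isTC (h : HSRep f g T) : IsTC T := ⟨f, g, h.summable_mul, h.2.2⟩

lemma comp_left {L : Type*} [NormedAddCommGroup L] [InnerProductSpace ℂ L]
    (h : HSRep f g T) (B : K →L[ℂ] L) : HSRep (fun n => B (f n)) g (B ∘L T) := by
  refine ⟨.of_nonneg_of_le (fun n => by positivity) (fun n => ?_) (h.1.mul_left (‖B‖ ^ 2)),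
    h.2.1, fun x => ?_⟩
  · rw [← mul_pow]; gcongr; exact B.le_opNorm _
  · simpa using (h.2.2 x).mapL B

lemma comp_right [CompleteSpace H] {L : Type*} [NormedAddCommGroup L] [InnerProductSpace ℂ L]
    [CompleteSpace L] (h : HSRep f g T) (B : L →L[ℂ] H) :
    HSRep f (fun n => adjoint B (g n)) (T ∘L B) := by
  refine ⟨h.1, .of_nonneg_of_le (fun n => by positivity) (fun n => ?_)
    (h.2.1.mul_left (‖adjoint B‖ ^ 2)), fun x => ?_⟩
  · rw [← mul_pow]; gcongr; exact (adjoint B).le_opNorm _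
  · simpa [adjoint_inner_left] using h.2.2 (B x)

end HSRep

lemma hasSum_norm_inner_sq (x : H) : HasSum (fun i => ‖⟪e i, x⟫‖ ^ 2) (‖x‖ ^ 2) := by
  have h := e.hasSum_inner_mul_inner x x
  have h' := Complex.hasSum_re h
  convert h' using 1
  · ext i
    rw [← inner_conj_symm x (e i), ← Complex.normSq_eq_conj_mul_self, Complex.ofReal_re,
      Complex.normSq_eq_norm_sq]
  · exact (inner_self_eq_norm_sq (𝕜 := ℂ) x).symm

/-- The trace of a trace-class operator converges absolutely and can be read off any
square-summable representation. -/
lemma HSRep.trace {f g : ℕ → H} {T : H →L[ℂ] H} (h : HSRep f g T) :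
    Summable (fun i => ⟪e i, T (e i)⟫) ∧ HasSum (fun n => ⟪g n, f n⟫) (trC e T) := by
  set F : ℕ → ι → ℂ := fun n i => ⟪g n, e i⟫ * ⟪e i, f n⟫
  have hF : ∀ n, HasSum (F n) ⟪g n, f n⟫ := fun n => e.hasSum_inner_mul_inner _ _
  have hb : ∀ n i, ‖F n i‖ ≤ ‖⟪e i, g n⟫‖ ^ 2 + ‖⟪e i, f n⟫‖ ^ 2 := fun n i => by
    rw [norm_mul, norm_inner_symm]
    nlinarith [sq_nonneg (‖⟪e i, g n⟫‖ - ‖⟪e i, f n⟫‖), sq_nonneg ‖⟪e i, g n⟫‖,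
      sq_nonneg ‖⟪e i, f n⟫‖]
  have hs : Summable (Function.uncurry F) := by
    have hG : Summable (fun p : ℕ × ι => ‖⟪e p.2, g p.1⟫‖ ^ 2 + ‖⟪e p.2, f p.1⟫‖ ^ 2) := by
      rw [summable_prod_of_nonneg (fun p => by positivity)]
      have : ∀ n, HasSum (fun i => ‖⟪e i, g n⟫‖ ^ 2 + ‖⟪e i, f n⟫‖ ^ 2)
          (‖g n‖ ^ 2 + ‖f n‖ ^ 2) :=
        fun n => (hasSum_norm_inner_sq e _).add (hasSum_norm_inner_sq e _)
      exact ⟨fun n => (this n).summable, by simpa only [(this _).tsum_eq] using h.2.1.add h.1⟩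
    exact .of_norm_bounded hG fun p => hb p.1 p.2
  have hT : ∀ i, HasSum (fun n => F n i) ⟪e i, T (e i)⟫ := fun i => by
    have := (h.2.2 (e i)).mapL (innerSL ℂ (e i))
    simpa [inner_smul_right, F] using this
  have hs' : Summable (Function.uncurry fun i n => F n i) := hs.prod_symm
  have h1 : HasSum (fun i => ⟪e i, T (e i)⟫) (∑' p, Function.uncurry (fun i n => F n i) p) :=
    hs'.hasSum.prod_fiberwise hT
  have h2 : HasSum (fun n => ⟪g n, f n⟫) (∑' p, Function.uncurry F p) :=
    hs.hasSum.prod_fiberwise hF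
  refine ⟨h1.summable, ?_⟩
  have : trC e T = ∑' p, Function.uncurry F p := by
    rw [trC, h1.tsum_eq]
    exact (Equiv.prodComm ℕ ι).symm.tsum_eq (Function.uncurry F)
  rwa [this]

lemma trC_smul (c : ℂ) (T : H →L[ℂ] H) : trC e (c • T) = c * trC e T := by
  simp [trC, tsum_mul_left]

namespace IsTC

variable {T S : H →L[ℂ] H}

lemma summable_diag (hT : IsTC T) : Summable (fun i => ⟪e i, T (e i)⟫) := by
  obtain ⟨f, g, h⟩ := hT.exists_rep
  exact (h.trace e).1

lemma comp_left {L : Type*} [NormedAddCommGroup L] [InnerProductSpace ℂ L] {T : H →L[ℂ] K}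
    (hT : IsTC T) (B : K →L[ℂ] L) : IsTC (B ∘L T) := by
  obtain ⟨f, g, h⟩ := hT.exists_rep
  exact (h.comp_left B).isTC

lemma smul {T : H →L[ℂ] K} (hT : IsTC T) (c : ℂ) : IsTC (c • T) := by
  convert hT.comp_left (c • (1 : K →L[ℂ] K)) using 1
  ext x; simp

lemma add {T S : H →L[ℂ] K} (hT : IsTC T) (hS : IsTC S) : IsTC (T + S) := by
  obtain ⟨f, g, hs, h⟩ := hT
  obtain ⟨f', g', hs', h'⟩ := hS
  let s := Equiv.natSumNatEquivNat
  refine ⟨Sum.elim f f' ∘ s.symm, Sum.elim g g' ∘ s.symm, ?_, fun x => ?_⟩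
  · rw [← s.summable_iff]
    simpa [Function.comp_def] using (HasSum.sum
      (f := fun i => ‖Sum.elim f f' i‖ * ‖Sum.elim g g' i‖) hs.hasSum hs'.hasSum).summable
  · rw [← s.hasSum_iff]
    simpa [Function.comp_def] using HasSum.sum
      (f := fun i => ⟪Sum.elim g g' i, x⟫ • Sum.elim f f' i) (h x) (h' x)

lemma sub {T S : H →L[ℂ] K} (hT : IsTC T) (hS : IsTC S) : IsTC (T - S) := by
  simpa [sub_eq_add_neg] using hT.add (hS.smul (-1))

lemma rankOne (y : K) (z : H) : IsTC (rankOne y z) := by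
  refine ⟨fun n => if n = 0 then y else 0, fun n => if n = 0 then z else 0, ?_, fun x => ?_⟩
  · exact summable_of_ne_finset_zero (s := {0}) fun n hn => by simp at hn; simp [hn]
  · convert hasSum_single (f := fun n : ℕ => ⟪if n = 0 then z else 0, x⟫ • if n = 0 then y else 0)
      0 (fun n hn => by simp [hn]) using 1
    simp [_root_.rankOne]

lemma trC_add (hT : IsTC T) (hS : IsTC S) : trC e (T + S) = trC e T + trC e S := by
  simp only [trC, add_apply, inner_add_right]
  exact (hT.summable_diag e).tsum_add (hS.summable_diag e)

lemma trC_sub (hT : IsTC T) (hS : IsTC S) : trC e (T - S) = trC e T - trC e S := by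
  simp only [trC, sub_apply, inner_sub_right]
  exact (hT.summable_diag e).tsum_sub (hS.summable_diag e)

lemma trC_comm [CompleteSpace H] (hT : IsTC T) (B : H →L[ℂ] H) :
    trC e (B ∘L T) = trC e (T ∘L B) := by
  obtain ⟨f, g, h⟩ := hT.exists_rep
  have h1 := ((h.comp_left B).trace e).2
  have h2 := ((h.comp_right B).trace e).2
  simp only [adjoint_inner_left] at h2
  exact h1.unique h2

/-- A constant bounding the trace pairing with `T`. -/
lemma exists_bound (hT : IsTC T) : ∃ C, 0 ≤ C ∧ ∀ B : H →L[ℂ] H, ‖trC e (B ∘L T)‖ ≤ ‖B‖ * C := by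
  obtain ⟨f, g, h⟩ := hT.exists_rep
  refine ⟨∑' n, ‖f n‖ * ‖g n‖, tsum_nonneg fun n => by positivity, fun B => ?_⟩
  rw [← ((h.comp_left B).trace e).2.tsum_eq, ← tsum_mul_left]
  refine tsum_of_norm_bounded (h.summable_mul.mul_left ‖B‖).hasSum fun n => ?_
  have h1 := norm_inner_le_norm (𝕜 := ℂ) (g n) (B (f n))
  have h2 := B.le_opNorm (f n)
  calc _ ≤ ‖g n‖ * ‖B (f n)‖ := h1
    _ ≤ ‖g n‖ * (‖B‖ * ‖f n‖) := by gcongr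
    _ = _ := by ring

/-- Pairing with a trace-class operator is continuous along bounded weakly convergent nets. -/
lemma tendsto_trC (hT : IsTC T) {α : Type*} {l : Filter α} {D : α → H →L[ℂ] H}
    {D₀ : H →L[ℂ] H} {C : ℝ} (hD : ∀ i, ‖D i‖ ≤ C)
    (h : ∀ x y, Tendsto (fun i => ⟪x, D i y⟫) l (𝓝 ⟪x, D₀ y⟫)) :
    Tendsto (fun i => trC e (D i ∘L T)) l (𝓝 (trC e (D₀ ∘L T))) := by
  obtain ⟨f, g, hfg⟩ := hT.exists_rep
  simp only [← ((hfg.comp_left _).trace e).2.tsum_eq]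
  refine tendsto_tsum_of_dominated_convergence (hfg.summable_mul.mul_left C) (fun n => h _ _)
    (Eventually.of_forall fun i n => ?_)
  calc _ ≤ ‖g n‖ * ‖D i (f n)‖ := norm_inner_le_norm _ _
    _ ≤ ‖g n‖ * (C * ‖f n‖) := by gcongr; exact (D i).le_of_opNorm_le (hD i) _
    _ = _ := by ring

end IsTC

@[simp] lemma rankOne_apply (y : K) (z x : H) : rankOne y z x = ⟪z, x⟫ • y := by
  simp [rankOne]

lemma trC_comp_rankOne (B : H →L[ℂ] H) (y z : H) : trC e (B ∘L rankOne y z) = ⟪z, B y⟫ := by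
  rw [← e.tsum_inner_mul_inner z (B y), trC]
  congr 1; ext i
  simp

lemma IsTC.trC_rankOne_comp [CompleteSpace H] {T : H →L[ℂ] H} (hT : IsTC T) (y z : H) :
    trC e (_root_.rankOne y z ∘L T) = ⟪z, T y⟫ := by
  rw [hT.trC_comm, trC_comp_rankOne]

lemma norm_rankOne_le (y : K) (z : H) : ‖rankOne y z‖ ≤ ‖y‖ * ‖z‖ := by
  refine opNorm_le_bound _ (by positivity) fun x => ?_
  rw [rankOne_apply, norm_smul]
  calc _ ≤ ‖z‖ * ‖x‖ * ‖y‖ := by gcongr; exact norm_inner_le_norm _ _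
    _ = _ := by ring

/-! ### The trace norm -/

lemma IsTC.bddAbove_tnorm {T : H →L[ℂ] H} (hT : IsTC T) :
    BddAbove { r : ℝ | ∃ B : H →L[ℂ] H, ‖B‖ ≤ 1 ∧ r = ‖trC e (B ∘L T)‖ } := by
  obtain ⟨C, hC, h⟩ := hT.exists_bound e
  refine ⟨C, ?_⟩
  rintro r ⟨B, hB, rfl⟩
  exact (h B).trans (by nlinarith)

lemma IsTC.norm_trC_le {T : H →L[ℂ] H} (hT : IsTC T) (B : H →L[ℂ] H) :
    ‖trC e (B ∘L T)‖ ≤ ‖B‖ * tnorm e T := by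
  rcases eq_or_ne B 0 with rfl | hB
  · simp [trC]
  have hB' : 0 < ‖B‖ := norm_pos_iff.2 hB
  have : ‖trC e ((((‖B‖⁻¹ : ℝ) : ℂ) • B) ∘L T)‖ ≤ tnorm e T :=
    le_csSup (hT.bddAbove_tnorm e) ⟨_, by
      rw [norm_smul, Complex.norm_real, norm_inv, norm_norm, inv_mul_cancel₀ hB'.ne'], rfl⟩
  rw [smul_comp, trC_smul, norm_mul, Complex.norm_real, norm_inv, norm_norm] at this
  rwa [inv_mul_le_iff₀ hB'] at this

lemma tnorm_nonneg (T : H →L[ℂ] H) : 0 ≤ tnorm e T :=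
  Real.sSup_nonneg (by rintro r ⟨B, -, rfl⟩; positivity)

lemma tnorm_le {T : H →L[ℂ] H} {C : ℝ} (h : ∀ B : H →L[ℂ] H, ‖B‖ ≤ 1 → ‖trC e (B ∘L T)‖ ≤ C) :
    tnorm e T ≤ C :=
  csSup_le ⟨_, 0, by simp, rfl⟩ (by rintro r ⟨B, hB, rfl⟩; exact h B hB)

lemma TNConv.tendsto_trC {a : ℕ → H →L[ℂ] H} {L : H →L[ℂ] H} (h : TNConv e a L)
    (ha : ∀ n, IsTC (a n)) (hL : IsTC L) (B : H →L[ℂ] H) :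
    Tendsto (fun n => trC e (B ∘L a n)) atTop (𝓝 (trC e (B ∘L L))) := by
  rw [tendsto_iff_norm_sub_tendsto_zero]
  refine squeeze_zero (fun n => norm_nonneg _) (fun n => ?_) (by simpa using h.const_mul ‖B‖)
  rw [← ((ha n).comp_left B).trC_sub e (hL.comp_left B), ← comp_sub]
  exact ((ha n).sub hL).norm_trC_le e B

lemma TNConv.tendsto_trC_one {a : ℕ → H →L[ℂ] H} {L : H →L[ℂ] H} (h : TNConv e a L)
    (ha : ∀ n, IsTC (a n)) (hL : IsTC L) :
    Tendsto (fun n => trC e (a n)) atTop (𝓝 (trC e L)) :=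
  h.tendsto_trC e ha hL 1

end TraceClass

section Positive

variable {H : Type*} [NormedAddCommGroup H] [InnerProductSpace ℂ H]

lemma isPositive_of_inner_nonneg {T : H →L[ℂ] H} (h : ∀ x, 0 ≤ ⟪x, T x⟫) : T.IsPositive := by
  rw [ContinuousLinearMap.isPositive_iff]
  have h' : ∀ x, 0 ≤ ⟪T x, x⟫ := fun x => by
    rw [← inner_conj_symm]
    exact star_nonneg_iff.2 (h x)
  refine ⟨fun x y => ?_, h'⟩
  have hs := (LinearMap.isSymmetric_iff_inner_map_self_real (T : H →ₗ[ℂ] H)).2 fun x =>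
    Complex.conj_eq_iff_im.2 (Complex.le_def.1 (h' x)).2.symm
  exact hs x y

lemma eq_of_tendsto_inner {α : Type*} {l : Filter α} [l.NeBot] {T : α → H →L[ℂ] H}
    {A B : H →L[ℂ] H} (hA : ∀ x y, Tendsto (fun i => ⟪x, T i y⟫) l (𝓝 ⟪x, A y⟫))
    (hB : ∀ x y, Tendsto (fun i => ⟪x, T i y⟫) l (𝓝 ⟪x, B y⟫)) : A = B := by
  ext y
  exact ext_inner_left ℂ fun x => tendsto_nhds_unique (hA x y) (hB x y)

lemma isPositive_of_tendsto_inner {α : Type*} {l : Filter α} [l.NeBot] {T : α → H →L[ℂ] H}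
    {A : H →L[ℂ] H} (hT : ∀ i, (T i).IsPositive)
    (hA : ∀ x y, Tendsto (fun i => ⟪x, T i y⟫) l (𝓝 ⟪x, A y⟫)) : A.IsPositive :=
  isPositive_of_inner_nonneg fun x =>
    ge_of_tendsto' (hA x x) fun i => (hT i).inner_nonneg_right x

/-- The norm of an operator is at most twice its numerical radius. -/
lemma opNorm_le_of_inner_self {T : H →L[ℂ] H} {M : ℝ} (hM : 0 ≤ M)
    (h : ∀ x, ‖⟪x, T x⟫‖ ≤ M * ‖x‖ ^ 2) : ‖T‖ ≤ 2 * M := by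
  have h' : ∀ x, ‖⟪T x, x⟫‖ ≤ M * ‖x‖ ^ 2 := fun x => by
    rw [norm_inner_symm]; exact h x
  have key : ∀ x y, ‖⟪T y, x⟫‖ ≤ M * (‖x‖ ^ 2 + ‖y‖ ^ 2) := fun x y => by
    have hp : ⟪T y, x⟫ = (⟪T (x + y), x + y⟫ - ⟪T (x - y), x - y⟫ +
        Complex.I * ⟪T (x + Complex.I • y), x + Complex.I • y⟫ -
        Complex.I * ⟪T (x - Complex.I • y), x - Complex.I • y⟫) / 4 :=
      inner_map_polarization (T : H →ₗ[ℂ] H) x y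
    have h1 := parallelogram_law_with_norm ℂ x y
    have h2 := parallelogram_law_with_norm ℂ x (Complex.I • y)
    rw [norm_smul, Complex.norm_I, one_mul] at h2
    rw [hp, norm_div]
    have h3 := h' (x + y)
    have h4 := h' (x - y)
    have h5 := h' (x + Complex.I • y)
    have h6 := h' (x - Complex.I • y)
    have h7 := (norm_sub_le (⟪T (x + y), x + y⟫ - ⟪T (x - y), x - y⟫ +
        Complex.I * ⟪T (x + Complex.I • y), x + Complex.I • y⟫)
        (Complex.I * ⟪T (x - Complex.I • y), x - Complex.I • y⟫))
    have h8 := norm_add_le (⟪T (x + y), x + y⟫ - ⟪T (x - y), x - y⟫)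
        (Complex.I * ⟪T (x + Complex.I • y), x + Complex.I • y⟫)
    have h9 := norm_sub_le ⟪T (x + y), x + y⟫ ⟪T (x - y), x - y⟫
    simp only [norm_mul, Complex.norm_I, one_mul] at h7 h8
    rw [show ‖(4 : ℂ)‖ = 4 by simp, div_le_iff₀ (by norm_num)]
    calc _ ≤ M * ‖x + y‖ ^ 2 + M * ‖x - y‖ ^ 2 + M * ‖x + Complex.I • y‖ ^ 2 +
          M * ‖x - Complex.I • y‖ ^ 2 := by linarith
      _ = M * (‖x + y‖ ^ 2 + ‖x - y‖ ^ 2) +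
          M * (‖x + Complex.I • y‖ ^ 2 + ‖x - Complex.I • y‖ ^ 2) := by ring
      _ = _ := by rw [h1, h2]; ring
  refine opNorm_le_of_re_inner_le (𝕜 := ℂ) (by positivity) fun y x hy hx => ?_
  refine (RCLike.re_le_norm _).trans ((key x y).trans_eq ?_)
  rw [hx, hy]; ring

lemma exists_sqrt [CompleteSpace H] {T : H →L[ℂ] H} (hT : T.IsPositive) :
    ∃ C : H →L[ℂ] H, (∀ x y, ⟪C x, y⟫ = ⟪x, C y⟫) ∧ C ∘L C = T := by
  have h0 : 0 ≤ T := (nonneg_iff_isPositive T).2 hT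
  refine ⟨CFC.sqrt T, fun x y => ?_, CFC.sqrt_mul_sqrt_self T h0⟩
  exact ((nonneg_iff_isPositive _).1 (CFC.sqrt_nonneg T)).inner_left_eq_inner_right x y

lemma norm_le_one_of_isPositive [CompleteSpace H] {T : H →L[ℂ] H} (hT : T.IsPositive)
    (h1 : (1 - T).IsPositive) : ‖T‖ ≤ 1 :=
  (CStarAlgebra.norm_le_one_iff_of_nonneg T ((nonneg_iff_isPositive T).2 hT)).2 h1

lemma norm_apply_sq_le [CompleteSpace H] {T : H →L[ℂ] H} (hT : T.IsPositive) (x : H) :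
    ‖T x‖ ^ 2 ≤ ‖T‖ * (⟪x, T x⟫).re := by
  obtain ⟨C, hC, rfl⟩ := exists_sqrt hT
  have key : ∀ y, ‖C y‖ ^ 2 = (⟪y, (C ∘L C) y⟫).re := fun y => by
    rw [comp_apply, ← hC, ← inner_self_eq_norm_sq (𝕜 := ℂ)]; rfl
  rw [← key x, comp_apply, key (C x)]
  calc _ ≤ ‖⟪C x, (C ∘L C) (C x)⟫‖ := Complex.re_le_norm _
    _ ≤ ‖C x‖ * (‖C ∘L C‖ * ‖C x‖) :=
        (norm_inner_le_norm _ _).trans (by gcongr; exact le_opNorm _ _)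
    _ = _ := by ring

lemma exists_posRep [CompleteSpace H] {T : H →L[ℂ] H} (e : HilbertBasis ℕ ℂ H) (hT : T.IsPositive)
    (hs : Summable fun i => (⟪e i, T (e i)⟫).re) : ∃ c, HSRep c c T := by
  obtain ⟨C, hC, rfl⟩ := exists_sqrt hT
  have key : ∀ i, ‖C (e i)‖ ^ 2 = (⟪e i, (C ∘L C) (e i)⟫).re := fun y => by
    rw [comp_apply, ← hC, ← inner_self_eq_norm_sq (𝕜 := ℂ)]; rfl
  refine ⟨fun i => C (e i), by simpa only [key] using hs, by simpa only [key] using hs, fun x => ?_⟩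
  simpa [e.repr_apply_apply, hC] using (e.hasSum_repr (C x)).mapL C

lemma IsPTC.exists_posRep [CompleteSpace H] {T : H →L[ℂ] H} (hT : IsPTC T)
    (e : HilbertBasis ℕ ℂ H) : ∃ c, HSRep c c T :=
  _root_.exists_posRep e hT.1 (Complex.hasSum_re (hT.2.summable_diag e).hasSum).summable

lemma exists_isPTC_hsRep [CompleteSpace H] {h : ℕ → H} (hs : Summable fun n => ‖h n‖ ^ 2) :
    ∃ Q : H →L[ℂ] H, IsPTC Q ∧ HSRep h h Q := by
  have hsum : Summable fun n => rankOne (h n) (h n) :=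
    .of_norm_bounded hs fun n => (norm_rankOne_le _ _).trans_eq (sq _).symm
  have hQ : HSRep h h (∑' n, rankOne (h n) (h n)) := ⟨hs, hs, fun x => by
    simpa using hsum.hasSum.mapL (ContinuousLinearMap.apply ℂ H x)⟩
  refine ⟨_, ⟨isPositive_of_inner_nonneg fun x => ?_, hQ.isTC⟩, hQ⟩
  have := (hQ.2.2 x).mapL (innerSL ℂ x)
  refine this.nonneg fun n => ?_
  simp only [innerSL_apply_apply, inner_smul_right]
  rw [← inner_conj_symm, ← Complex.normSq_eq_conj_mul_self]
  exact_mod_cast Complex.normSq_nonneg _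

variable {e : HilbertBasis ℕ ℂ H}

lemma IsPTC.trC_comp_nonneg [CompleteSpace H] {T D : H →L[ℂ] H} (hT : IsPTC T) (hD : D.IsPositive) :
    0 ≤ trC e (D ∘L T) := by
  obtain ⟨c, hc⟩ := hT.exists_posRep e
  exact ((hc.comp_left D).trace e).2.nonneg fun n => hD.inner_nonneg_right _

lemma IsPTC.trC_nonneg [CompleteSpace H] {T : H →L[ℂ] H} (hT : IsPTC T) : 0 ≤ trC e T := by
  simpa [ContinuousLinearMap.one_def] using
    hT.trC_comp_nonneg (e := e) ContinuousLinearMap.isPositive_one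

lemma isPTC_rankOne_self (y : H) : IsPTC (rankOne y y) := by
  refine ⟨isPositive_of_inner_nonneg fun x => ?_, .rankOne y y⟩
  rw [rankOne_apply, inner_smul_right, ← inner_conj_symm, ← Complex.normSq_eq_conj_mul_self]
  exact_mod_cast Complex.normSq_nonneg _

lemma trC_rankOne (y z : H) : trC e (rankOne y z) = ⟪z, y⟫ := by
  simpa [ContinuousLinearMap.one_def] using trC_comp_rankOne e 1 y z

/-- The trace pairing `B ↦ Tr(B T)` with a trace-class operator. -/
def IsTC.pairing {T : H →L[ℂ] H} (hT : IsTC T) (e : HilbertBasis ℕ ℂ H) :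
    (H →L[ℂ] H) →ₗ[ℂ] ℂ where
  toFun B := trC e (B ∘L T)
  map_add' B C := by rw [add_comp, (hT.comp_left B).trC_add e (hT.comp_left C)]
  map_smul' c B := by simp [trC, ← tsum_mul_left]

lemma IsTC.pairing_apply {T : H →L[ℂ] H} (hT : IsTC T) (B : H →L[ℂ] H) :
    hT.pairing e B = trC e (B ∘L T) := rfl

/-- Every trace-class operator is a combination of four positive ones. -/
lemma IsTC.exists_decomposition [CompleteSpace H] {T : H →L[ℂ] H} (hT : IsTC T) :
    ∃ Q : Fin 4 → H →L[ℂ] H, (∀ l, IsPTC (Q l)) ∧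
      T = (1 / 4 : ℂ) • (Q 0 + Complex.I • Q 1 + (-1 : ℂ) • Q 2 + (-Complex.I) • Q 3) := by
  obtain ⟨f, g, hf, hg, h⟩ := hT.exists_rep
  have hs : ∀ l : Fin 4, Summable fun n => ‖f n + Complex.I ^ (l : ℕ) • g n‖ ^ 2 := fun l => by
    refine .of_nonneg_of_le (fun n => by positivity) (fun n => ?_) ((hf.add hg).mul_left 2)
    have : ‖f n + Complex.I ^ (l : ℕ) • g n‖ ≤ ‖f n‖ + ‖g n‖ :=
      (norm_add_le _ _).trans (by simp [norm_smul])
    calc _ ≤ (‖f n‖ + ‖g n‖) ^ 2 := by gcongr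
      _ ≤ _ := by nlinarith [sq_nonneg (‖f n‖ - ‖g n‖)]
  choose Q hQ hrep using fun l => exists_isPTC_hsRep (hs l)
  refine ⟨Q, hQ, ContinuousLinearMap.ext fun x => (h x).unique ?_⟩
  have := ((((hrep 0).2.2 x).add (((hrep 1).2.2 x).const_smul Complex.I)).add
    (((hrep 2).2.2 x).const_smul (-1 : ℂ))).add (((hrep 3).2.2 x).const_smul (-Complex.I))
  convert this.const_smul (1 / 4 : ℂ) using 1
  · ext n
    simp only [inner_add_left, inner_smul_left, Fin.val_zero, Fin.val_one, Fin.val_two, pow_zero,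
      pow_one, show ((3 : Fin 4) : ℕ) = 3 from rfl, Complex.I_sq, Complex.I_pow_three, map_one,
      map_neg, Complex.conj_I, one_smul]
    match_scalars <;> ring_nf <;> simp only [Complex.I_sq] <;> ring
  · rfl

end Positive

section WeakLimits

variable {H K : Type*} [NormedAddCommGroup H] [InnerProductSpace ℂ H]
  [NormedAddCommGroup K] [InnerProductSpace ℂ K]

lemma tendsto_inner_swap {α : Type*} {l : Filter α} {u v : α → H} {c : ℂ}
    (h : Tendsto (fun i => ⟪u i, v i⟫) l (𝓝 c)) :
    Tendsto (fun i => ⟪v i, u i⟫) l (𝓝 (starRingEnd ℂ c)) := by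
  simp only [← inner_conj_symm (v _)]
  exact (Complex.continuous_conj.tendsto c).comp h

lemma tendsto_zero_of_dense_span {E F α : Type*} [NormedAddCommGroup E] [NormedSpace ℂ E]
    [NormedAddCommGroup F] [NormedSpace ℂ F] {l : Filter α} {g : α → E →L[ℂ] F} {C : ℝ}
    (hg : ∀ i, ‖g i‖ ≤ C) {S : Set E} (hS : (Submodule.span ℂ S).topologicalClosure = ⊤)
    (h : ∀ s ∈ S, Tendsto (fun i => g i s) l (𝓝 0)) (x : E) :
    Tendsto (fun i => g i x) l (𝓝 0) := by
  have hspan : ∀ y ∈ Submodule.span ℂ S, Tendsto (fun i => g i y) l (𝓝 0) := by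
    intro y hy
    induction hy using Submodule.span_induction with
    | mem y hy => exact h y hy
    | zero => simpa using tendsto_const_nhds
    | add y z _ _ hy hz => simpa using hy.add hz
    | smul c y _ hy => simpa using hy.const_smul c
  have hx : x ∈ closure (Submodule.span ℂ S : Set E) := by
    rw [← Submodule.topologicalClosure_coe, hS]; trivial
  rw [Metric.tendsto_nhds]
  intro ε hε
  obtain ⟨y, hy, hxy⟩ := Metric.mem_closure_iff.1 hx (ε / (2 * (|C| + 1))) (by positivity)
  filter_upwards [Metric.tendsto_nhds.1 (hspan y hy) (ε / 2) (by positivity)] with i hi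
  rw [dist_zero_right] at hi ⊢
  rw [dist_eq_norm] at hxy
  have h1 : ‖g i (x - y)‖ ≤ (|C| + 1) * (ε / (2 * (|C| + 1))) :=
    (g i).le_of_opNorm_le_of_le ((hg i).trans (by linarith [le_abs_self C])) hxy.le
  have h2 : (|C| + 1) * (ε / (2 * (|C| + 1))) = ε / 2 := by field_simp
  calc ‖g i x‖ = ‖g i (x - y) + g i y‖ := by rw [← map_add, sub_add_cancel]
    _ ≤ ‖g i (x - y)‖ + ‖g i y‖ := norm_add_le _ _
    _ < ε := by linarith

/-- A bounded net of operators with convergent matrix elements has a weak-operator limit. -/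
lemma exists_weak_limit_of_forall [CompleteSpace H] {α : Type*} {l : Filter α} [l.NeBot]
    {T : α → H →L[ℂ] H} {C : ℝ} (hT : ∀ i, ‖T i‖ ≤ C)
    (h : ∀ x y, ∃ c, Tendsto (fun i => ⟪x, T i y⟫) l (𝓝 c)) :
    ∃ A : H →L[ℂ] H, ‖A‖ ≤ C ∧ ∀ x y, Tendsto (fun i => ⟪x, T i y⟫) l (𝓝 ⟪x, A y⟫) := by
  have hC : 0 ≤ C := by
    obtain ⟨i⟩ := l.nonempty_of_neBot
    exact (norm_nonneg _).trans (hT i)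
  have h' : ∀ x y, ∃ c, Tendsto (fun i => ⟪T i x, y⟫) l (𝓝 c) := fun x y => by
    obtain ⟨c, hc⟩ := h y x
    exact ⟨_, tendsto_inner_swap hc⟩
  choose b hb using h'
  let B : H →L⋆[ℂ] H →L[ℂ] ℂ := LinearMap.mkContinuous₂
    (LinearMap.mk₂'ₛₗ (starRingEnd ℂ) (RingHom.id ℂ) b
      (fun x x' y => tendsto_nhds_unique (hb _ _) (by
        simpa only [map_add, inner_add_left] using (hb x y).add (hb x' y)))
      (fun c x y => tendsto_nhds_unique (hb _ _) (by
        simpa only [map_smul, inner_smul_left, smul_eq_mul] using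
          (hb x y).const_mul (starRingEnd ℂ c)))
      (fun x y y' => tendsto_nhds_unique (hb _ _) (by
        simpa only [inner_add_right] using (hb x y).add (hb x y')))
      (fun c x y => tendsto_nhds_unique (hb _ _) (by
        simpa only [inner_smul_right, smul_eq_mul, RingHom.id_apply] using
          (hb x y).const_mul c))) C
    (fun x y => le_of_tendsto (hb x y).norm (Eventually.of_forall fun i => by
      refine (norm_inner_le_norm _ _).trans ?_
      gcongr
      exact (T i).le_of_opNorm_le (hT i) x))
  refine ⟨InnerProductSpace.continuousLinearMapOfBilin B, ?_, fun x y => ?_⟩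
  · refine opNorm_le_of_re_inner_le hC fun x y hx hy => ?_
    rw [InnerProductSpace.continuousLinearMapOfBilin_apply]
    refine (Complex.re_le_norm _).trans ?_
    have h1 := (B x).le_opNorm y
    have h2 := B.le_of_opNorm_le (LinearMap.mkContinuous₂_norm_le _ hC _) x
    rw [hy, mul_one] at h1
    rw [hx, mul_one] at h2
    exact h1.trans h2
  · rw [← inner_conj_symm]
    simp only [InnerProductSpace.continuousLinearMapOfBilin_apply]
    exact tendsto_inner_swap (hb y x)

lemma tendsto_inner_of_basis {α : Type*} {l : Filter α} (e : HilbertBasis ℕ ℂ H)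
    {T : α → H →L[ℂ] H} {A : H →L[ℂ] H} {C : ℝ} (hT : ∀ i, ‖T i‖ ≤ C)
    (h : ∀ p q, Tendsto (fun i => ⟪e p, T i (e q)⟫) l (𝓝 ⟪e p, A (e q)⟫)) (x y : H) :
    Tendsto (fun i => ⟪x, T i y⟫) l (𝓝 ⟪x, A y⟫) := by
  have hn : ∀ i, ‖T i - A‖ ≤ C + ‖A‖ := fun i =>
    (norm_sub_le _ _).trans (by gcongr; exact hT i)
  have h1 : ∀ p y, Tendsto (fun i => ⟪e p, (T i - A) y⟫) l (𝓝 0) := fun p y => by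
    refine tendsto_zero_of_dense_span (g := fun i => innerSL ℂ (e p) ∘L (T i - A))
      (C := C + ‖A‖) (fun i => ?_) e.dense_span ?_ y
    · refine (opNorm_comp_le _ _).trans ?_
      rw [innerSL_apply_norm, e.orthonormal.norm_eq_one, one_mul]
      exact hn i
    · rintro _ ⟨q, rfl⟩
      simpa [inner_sub_right] using (h p q).sub_const ⟪e p, A (e q)⟫
  have h2 : Tendsto (fun i => ⟪(T i - A) y, x⟫) l (𝓝 0) := by
    refine tendsto_zero_of_dense_span (g := fun i => innerSL ℂ ((T i - A) y))
      (C := (C + ‖A‖) * ‖y‖) (fun i => ?_) e.dense_span ?_ x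
    · rw [innerSL_apply_norm]
      exact (T i - A).le_of_opNorm_le (hn i) y
    · rintro _ ⟨q, rfl⟩
      simpa only [innerSL_apply_apply, map_zero] using tendsto_inner_swap (h1 q y)
  rw [← tendsto_sub_nhds_zero_iff]
  simpa only [map_zero, sub_apply, inner_sub_right] using tendsto_inner_swap h2

/-- A bounded sequence of operators whose matrix elements in a Hilbert basis converge has a
weak-operator limit. -/
lemma exists_weak_limit_of_basis [CompleteSpace H] (e : HilbertBasis ℕ ℂ H)
    {T : ℕ → H →L[ℂ] H} {C : ℝ} (hT : ∀ n, ‖T n‖ ≤ C)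
    (h : ∀ p q, ∃ c, Tendsto (fun n => ⟪e p, T n (e q)⟫) atTop (𝓝 c)) :
    ∃ A : H →L[ℂ] H, ∀ x y, Tendsto (fun n => ⟪x, T n y⟫) atTop (𝓝 ⟪x, A y⟫) := by
  let U : Ultrafilter ℕ := Filter.hyperfilter ℕ
  have hU : (U : Filter ℕ) ≤ atTop := by
    rw [← Nat.cofinite_eq_atTop]; exact Filter.hyperfilter_le_cofinite
  obtain ⟨A, -, hA⟩ := exists_weak_limit_of_forall (l := (U : Filter ℕ)) hT fun x y => by
    obtain ⟨c, -, hc⟩ := (isCompact_closedBall (0 : ℂ) (‖x‖ * (C * ‖y‖))).ultrafilter_le_nhds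
      (U.map fun n => ⟪x, T n y⟫) (by
        rw [le_principal_iff]
        refine Filter.mem_map.2 (Filter.univ_mem' fun n => ?_)
        rw [Set.mem_preimage, mem_closedBall_zero_iff]
        exact (norm_inner_le_norm _ _).trans (by gcongr; exact (T n).le_of_opNorm_le (hT n) y))
    exact ⟨c, hc⟩
  refine ⟨A, tendsto_inner_of_basis e hT fun p q => ?_⟩
  obtain ⟨c, hc⟩ := h p q
  rwa [tendsto_nhds_unique (hA (e p) (e q)) (hc.mono_left hU)]

/-- Diagonal weak-operator compactness for countably many bounded sequences of operators. -/
lemma exists_subseq_weak_limit [CompleteSpace H] (e : HilbertBasis ℕ ℂ H) {κ : Type*} [Countable κ]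
    {T : κ → ℕ → H →L[ℂ] H} {C : ℝ} (hT : ∀ m n, ‖T m n‖ ≤ C) :
    ∃ φ : ℕ → ℕ, StrictMono φ ∧ ∃ A : κ → H →L[ℂ] H, ∀ m x y,
      Tendsto (fun n => ⟪x, T m (φ n) y⟫) atTop (𝓝 ⟪x, A m y⟫) := by
  let F : ℕ → κ × ℕ × ℕ → ℂ := fun n p => ⟪e p.2.1, T p.1 n (e p.2.2)⟫
  have hK : IsCompact (Set.univ.pi fun _ : κ × ℕ × ℕ => Metric.closedBall (0 : ℂ) C) :=
    isCompact_univ_pi fun _ => isCompact_closedBall _ _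
  obtain ⟨c, -, φ, hφ, hc⟩ := hK.tendsto_subseq (x := F) fun n p _ => by
    rw [mem_closedBall_zero_iff]
    refine (norm_inner_le_norm _ _).trans ?_
    rw [e.orthonormal.norm_eq_one, one_mul]
    simpa [e.orthonormal.norm_eq_one] using (T p.1 n).le_of_opNorm_le (hT p.1 n) (e p.2.2)
  rw [tendsto_pi_nhds] at hc
  choose A hA using fun m => exists_weak_limit_of_basis e (T := fun n => T m (φ n))
    (fun n => hT m _) fun p q => ⟨_, hc (m, p, q)⟩
  exact ⟨φ, hφ, A, hA⟩

end WeakLimits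

section Faithful

variable {H : Type*} [NormedAddCommGroup H] [InnerProductSpace ℂ H] [CompleteSpace H]
  {e : HilbertBasis ℕ ℂ H}

/-- Positive contractions that vanish in the mean of a faithful state vanish strongly. -/
lemma IsFaithfulState.tendsto_zero {σ : H →L[ℂ] H} (hσ : IsFaithfulState e σ) {α : Type*}
    {l : Filter α} {D : α → H →L[ℂ] H} (hD : ∀ i, (D i).IsPositive) (hD1 : ∀ i, ‖D i‖ ≤ 1)
    (h : Tendsto (fun i => (trC e (D i ∘L σ)).re) l (𝓝 0)) (x : H) :
    Tendsto (fun i => D i x) l (𝓝 0) := by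
  obtain ⟨c, hc⟩ := IsPTC.exists_posRep ⟨hσ.1.1, hσ.1.2.1⟩ e
  refine tendsto_zero_of_dense_span (S := Set.range c) hD1 ?_ ?_ x
  · rw [Submodule.topologicalClosure_eq_top_iff, Submodule.eq_bot_iff]
    intro y hy
    refine hσ.2 y ((hc.2.2 y).unique ?_)
    have : ∀ n, ⟪c n, y⟫ = 0 := fun n => hy (c n) (Submodule.subset_span ⟨n, rfl⟩)
    simp [this]
  · rintro _ ⟨n, rfl⟩
    have hle : ∀ i, ‖D i (c n)‖ ^ 2 ≤ (trC e (D i ∘L σ)).re := fun i => by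
      have h1 := Complex.hasSum_re ((hc.comp_left (D i)).trace e).2
      calc ‖D i (c n)‖ ^ 2 ≤ ‖D i‖ * (⟪c n, D i (c n)⟫).re := norm_apply_sq_le (hD i) _
        _ ≤ 1 * (⟪c n, D i (c n)⟫).re := by
          gcongr
          · exact (hD i).re_inner_nonneg_right _
          · exact hD1 i
        _ ≤ _ := by
          rw [one_mul]
          exact le_hasSum h1 n fun k _ => (hD i).re_inner_nonneg_right _
    have h2 := squeeze_zero (fun i => by positivity) hle h
    rw [tendsto_zero_iff_norm_tendsto_zero]
    simpa [Real.sqrt_sq] using h2.sqrt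

lemma IsFaithfulState.tendsto_trC_zero {σ : H →L[ℂ] H} (hσ : IsFaithfulState e σ) {α : Type*}
    {l : Filter α} {D : α → H →L[ℂ] H} (hD : ∀ i, (D i).IsPositive) (hD1 : ∀ i, ‖D i‖ ≤ 1)
    (h : Tendsto (fun i => (trC e (D i ∘L σ)).re) l (𝓝 0)) {ρ : H →L[ℂ] H} (hρ : IsTC ρ) :
    Tendsto (fun i => (trC e (D i ∘L ρ)).re) l (𝓝 0) := by
  have := hρ.tendsto_trC e (D₀ := 0) hD1 fun x y => by
    simpa using (tendsto_const_nhds (x := x)).inner (𝕜 := ℂ) (hσ.tendsto_zero hD hD1 h y)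
  simpa [trC, Function.comp_def] using (Complex.continuous_re.tendsto _).comp this

lemma exists_faithfulState (e : HilbertBasis ℕ ℂ H) : ∃ σ, IsFaithfulState e σ := by
  let h : ℕ → H := fun n => ((Real.sqrt ((1 / 2) ^ (n + 1)) : ℝ) : ℂ) • e n
  have hn : ∀ n, ‖h n‖ ^ 2 = (1 / 2) ^ (n + 1) := fun n => by
    rw [norm_smul, e.orthonormal.norm_eq_one, mul_one, Complex.norm_real, Real.norm_eq_abs,
      sq_abs, Real.sq_sqrt (by positivity)]
  have hsum : HasSum (fun n => ‖h n‖ ^ 2) 1 := by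
    simp only [hn, pow_succ]
    simpa only [show (2 : ℝ) * (1 / 2) = 1 by norm_num] using
      hasSum_geometric_two.mul_right (1 / 2 : ℝ)
  obtain ⟨Q, hQ, hrep⟩ := exists_isPTC_hsRep hsum.summable
  refine ⟨Q, ⟨hQ.1, hQ.2, ?_⟩, fun x hx => ?_⟩
  · refine (hrep.trace e).2.unique ?_
    simp only [inner_self_eq_norm_sq_to_K]
    exact_mod_cast hsum.mapL Complex.ofRealCLM
  · have h1 := Complex.hasSum_re ((hrep.2.2 x).mapL (innerSL ℂ x))
    simp only [innerSL_apply_apply, inner_smul_right] at h1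
    have key : ∀ n, (⟪h n, x⟫ * ⟪x, h n⟫).re = ‖⟪h n, x⟫‖ ^ 2 := fun n => by
      rw [← inner_conj_symm x, Complex.mul_conj, Complex.ofReal_re, Complex.normSq_eq_norm_sq]
    simp only [key, hx, inner_zero_right, Complex.zero_re] at h1
    rw [hasSum_zero_iff_of_nonneg (fun n => by positivity)] at h1
    have h2 : ∀ n, ⟪e n, x⟫ = 0 := fun n => by
      have h3 := congrFun h1 n
      simp only [Pi.zero_apply, ne_eq, OfNat.ofNat_ne_zero, not_false_eq_true, pow_eq_zero_iff,
        norm_eq_zero, h, inner_smul_left, mul_eq_zero, Complex.conj_ofReal,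
        Complex.ofReal_eq_zero] at h3
      exact h3.resolve_left (Real.sqrt_pos.2 (by positivity)).ne'
    refine (e.hasSum_repr x).unique ?_
    simp [e.repr_apply_apply, h2]

end Faithful

section Projections

variable {H : Type*} [NormedAddCommGroup H] [InnerProductSpace ℂ H]
  {P : H →L[ℂ] H}

lemma zero_le_inner_self (x : H) : 0 ≤ ⟪x, x⟫ := by
  rw [inner_self_eq_norm_sq_to_K, ← RCLike.ofReal_pow]
  exact Complex.zero_le_real.2 (sq_nonneg ‖x‖)

variable [CompleteSpace H]

namespace IsFinRankProj

lemma inner_left (hP : IsFinRankProj P) (x y : H) : ⟪P x, y⟫ = ⟪x, P y⟫ := by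
  rw [← adjoint_inner_right, hP.1.adjoint_eq]

lemma apply_apply (hP : IsFinRankProj P) (x : H) : P (P x) = P x :=
  DFunLike.congr_fun hP.2.1 x

lemma isPositive (hP : IsFinRankProj P) : P.IsPositive :=
  isPositive_of_inner_nonneg fun x => by
    rw [← hP.apply_apply, ← hP.inner_left]
    exact zero_le_inner_self _

lemma re_inner_compl (hP : IsFinRankProj P) (x : H) :
    (⟪x, (1 - P) x⟫).re = ‖(1 - P) x‖ ^ 2 := by
  rw [← inner_self_eq_norm_sq (𝕜 := ℂ)]
  simp only [sub_apply, one_apply_eq_self, inner_sub_left, inner_sub_right, hP.inner_left,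
    hP.apply_apply]
  simp

lemma isPositive_compl (hP : IsFinRankProj P) : (1 - P).IsPositive :=
  isPositive_of_inner_nonneg fun x => by
    have : ⟪x, (1 - P) x⟫ = ⟪(1 - P) x, (1 - P) x⟫ := by
      simp only [sub_apply, one_apply_eq_self, inner_sub_left, inner_sub_right, hP.inner_left,
        hP.apply_apply]
      ring
    rw [this]
    exact zero_le_inner_self _

lemma norm_apply_le (hP : IsFinRankProj P) (x : H) : ‖P x‖ ≤ ‖x‖ :=
  (P.le_of_opNorm_le (norm_le_one_of_isPositive hP.isPositive hP.isPositive_compl) x).trans_eq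
    (one_mul _)

lemma exists_expansion (hP : IsFinRankProj P) : ∃ (r : ℕ) (p : Fin r → H),
    ∀ x, P x = ∑ i, ⟪p i, x⟫ • p i := by
  have := hP.2.2
  let b := stdOrthonormalBasis ℂ (LinearMap.range (P : H →ₗ[ℂ] H))
  have hb : ∀ i, P (b i : H) = b i := fun i => by
    obtain ⟨y, hy⟩ := (b i).2
    rw [← hy]; exact hP.apply_apply y
  refine ⟨_, fun i => (b i : H), fun x => ?_⟩
  have h := congrArg Subtype.val (b.sum_repr' (⟨P x, x, rfl⟩ : LinearMap.range (P : H →ₗ[ℂ] H)))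
  simp only [Submodule.coe_sum, Submodule.coe_smul, Submodule.coe_inner] at h
  rw [← h]
  refine Finset.sum_congr rfl fun i _ => ?_
  rw [← hP.inner_left, hb]

end IsFinRankProj

namespace ProjSeq

variable {P : ℕ → H →L[ℂ] H}

lemma isPositive_sub (hP : ProjSeq P) (m : ℕ) : (P (m + 1) - P m).IsPositive := by
  refine isPositive_of_inner_nonneg fun x => ?_
  have h1 : ∀ y, P (m + 1) (P m y) = P m y := fun y => DFunLike.congr_fun (hP.2.1 m) y
  have h2 : ∀ y, P m (P (m + 1) y) = P m y := fun y => ext_inner_left ℂ fun z => by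
    rw [← (hP.1 m).inner_left, ← (hP.1 (m + 1)).inner_left, h1, (hP.1 m).inner_left]
  have : ⟪x, (P (m + 1) - P m) x⟫ = ⟪(P (m + 1) - P m) x, (P (m + 1) - P m) x⟫ := by
    simp only [sub_apply, inner_sub_left, inner_sub_right, (hP.1 _).inner_left,
      (hP.1 _).apply_apply, h1, h2]
    ring
  rw [this]
  exact zero_le_inner_self _

end ProjSeq

/-- The projections onto the spans of the initial segments of a Hilbert basis. -/
lemma exists_projSeq (e : HilbertBasis ℕ ℂ H) : ∃ P : ℕ → H →L[ℂ] H, ProjSeq P := by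
  classical
  let P : ℕ → H →L[ℂ] H := fun m => ∑ i ∈ Finset.range m, rankOne (e i) (e i)
  have hP : ∀ m x, P m x = ∑ i ∈ Finset.range m, ⟪e i, x⟫ • e i := fun m x => by
    simp [P, sum_apply]
  have hinner : ∀ m i x, ⟪e i, P m x⟫ = if i < m then ⟪e i, x⟫ else 0 := fun m i x => by
    simp [hP, orthonormal_iff_ite.1 e.orthonormal]
  refine ⟨P, fun m => ⟨?_, ?_, ?_⟩, fun m => ?_, fun x => ?_⟩
  · rw [ContinuousLinearMap.isSelfAdjoint_iff_isSymmetric]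
    intro x y
    simp only [ContinuousLinearMap.coe_coe, hP, sum_inner, inner_sum, inner_smul_left,
      inner_smul_right, inner_conj_symm]
    exact Finset.sum_congr rfl fun i _ => mul_comm _ _
  · ext x
    rw [comp_apply, hP m (P m x), hP m x]
    refine Finset.sum_congr rfl fun i hi => ?_
    rw [← hP m x, hinner, if_pos (Finset.mem_range.1 hi)]
  · refine Submodule.finiteDimensional_of_le
      (S₂ := Submodule.span ℂ ((Finset.range m).image e : Set H)) ?_
    rintro _ ⟨x, rfl⟩
    rw [ContinuousLinearMap.coe_coe, hP]
    exact Submodule.sum_mem _ fun i hi => Submodule.smul_mem _ _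
      (Submodule.subset_span (by simpa using ⟨i, Finset.mem_range.1 hi, rfl⟩))
  · ext x
    rw [comp_apply, hP (m + 1) (P m x)]
    rw [Finset.sum_range_succ, hinner, if_neg (lt_irrefl m), zero_smul, add_zero, hP m x]
    refine Finset.sum_congr rfl fun i hi => ?_
    rw [← hP m x, hinner, if_pos (Finset.mem_range.1 hi)]
  · simpa only [hP, ← e.repr_apply_apply] using (e.hasSum_repr x).tendsto_sum_nat

variable {e : HilbertBasis ℕ ℂ H}

/-- Tails of a trace-class operator along an increasing sequence of projections vanish. -/
lemma IsTC.tendsto_tail {T : H →L[ℂ] H} (hT : IsTC T) {P : ℕ → H →L[ℂ] H} (hP : ProjSeq P) :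
    Tendsto (fun m => (trC e ((1 - P m) ∘L T)).re) atTop (𝓝 0) := by
  have := hT.tendsto_trC e (D := fun m => 1 - P m) (D₀ := 0) (l := atTop) (C := 1) (fun m =>
    norm_le_one_of_isPositive (hP.1 m).isPositive_compl (by simpa using (hP.1 m).isPositive))
    fun x y => by
      have h := (tendsto_const_nhds (x := x)).inner (𝕜 := ℂ) ((hP.2.2 y).const_sub y)
      rwa [sub_self] at h
  have h0 : trC e ((0 : H →L[ℂ] H) ∘L T) = 0 := by simp [trC]
  rw [h0] at this
  exact (Complex.continuous_re.tendsto _).comp this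

/-- Compressing a positive trace-class operator by a projection changes traces only by an amount
controlled by the tail. -/
lemma IsPTC.norm_trC_sub_compression_le {T : H →L[ℂ] H} (hT : IsPTC T) (hP : IsFinRankProj P)
    {B : H →L[ℂ] H} (hB : ‖B‖ ≤ 1) {t : ℝ} (ht : 0 < t) :
    ‖trC e (B ∘L T) - trC e ((P ∘L B ∘L P) ∘L T)‖ ≤
      t * (trC e T).re + (trC e ((1 - P) ∘L T)).re / t := by
  obtain ⟨c, hc⟩ := hT.exists_posRep e
  have h1 := ((hc.comp_left B).trace e).2
  have h2 := ((hc.comp_left (P ∘L B ∘L P)).trace e).2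
  have h3 := Complex.hasSum_re (hc.trace e).2
  have h4 := Complex.hasSum_re ((hc.comp_left (1 - P)).trace e).2
  rw [← (h1.sub h2).tsum_eq]
  refine tsum_of_norm_bounded ((h3.mul_left t).add (h4.div_const t)) fun n => ?_
  have hself : (⟪c n, c n⟫).re = ‖c n‖ ^ 2 := inner_self_eq_norm_sq (𝕜 := ℂ) (c n)
  rw [hP.re_inner_compl, hself]
  have hsplit : ⟪c n, B (c n)⟫ - ⟪c n, (P ∘L B ∘L P) (c n)⟫ =
      ⟪(1 - P) (c n), B (c n)⟫ + ⟪P (c n), B ((1 - P) (c n))⟫ := by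
    simp only [comp_apply, sub_apply, one_apply_eq_self, inner_sub_left, map_sub, inner_sub_right,
      hP.inner_left]
    ring
  have hB' : ∀ x, ‖B x‖ ≤ ‖x‖ := fun x => (B.le_of_opNorm_le hB x).trans_eq (one_mul _)
  rw [hsplit]
  have e1 : ‖⟪(1 - P) (c n), B (c n)⟫‖ ≤ ‖(1 - P) (c n)‖ * ‖c n‖ :=
    (norm_inner_le_norm _ _).trans (by gcongr; exact hB' _)
  have e2 : ‖⟪P (c n), B ((1 - P) (c n))⟫‖ ≤ ‖c n‖ * ‖(1 - P) (c n)‖ :=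
    (norm_inner_le_norm _ _).trans (by gcongr; exacts [hP.norm_apply_le _, hB' _])
  refine (norm_add_le _ _).trans ((add_le_add e1 e2).trans ?_)
  rw [← sub_nonneg]
  have : t * ‖c n‖ ^ 2 + ‖(1 - P) (c n)‖ ^ 2 / t
      - (‖(1 - P) (c n)‖ * ‖c n‖ + ‖c n‖ * ‖(1 - P) (c n)‖) =
      (t * ‖c n‖ - ‖(1 - P) (c n)‖) ^ 2 / t := by
    field_simp; ring
  rw [this]; positivity

lemma trC_compression_le {X : H →L[ℂ] H} (hX : IsTC X) {r : ℕ} {p : Fin r → H}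
    (hp : ∀ x, P x = ∑ i, ⟪p i, x⟫ • p i) {B : H →L[ℂ] H} (hB : ‖B‖ ≤ 1) :
    ‖trC e ((P ∘L B ∘L P) ∘L X)‖ ≤ ∑ i, ∑ j, ‖p i‖ * ‖p j‖ * ‖⟪p j, X (p i)⟫‖ := by
  have hexp : P ∘L B ∘L P = ∑ i, ∑ j, ⟪p i, B (p j)⟫ • rankOne (p i) (p j) := by
    ext x
    simp only [comp_apply, hp, map_sum, map_smul, inner_sum, inner_smul_right, Finset.sum_smul,
      sum_apply, smul_apply, rankOne_apply, smul_smul]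
    simp only [mul_comm]
  have hsum : trC e ((P ∘L B ∘L P) ∘L X) = ∑ i, ∑ j, ⟪p i, B (p j)⟫ * ⟪p j, X (p i)⟫ := by
    rw [← hX.pairing_apply (e := e), hexp, map_sum]
    refine Finset.sum_congr rfl fun i _ => ?_
    rw [map_sum]
    refine Finset.sum_congr rfl fun j _ => ?_
    rw [map_smul, hX.pairing_apply, hX.trC_rankOne_comp, smul_eq_mul]
  rw [hsum]
  refine norm_sum_le_of_le _ fun i _ => norm_sum_le_of_le _ fun j _ => ?_
  rw [norm_mul]
  gcongr
  refine (norm_inner_le_norm _ _).trans ?_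
  gcongr
  exact (B.le_of_opNorm_le hB _).trans_eq (one_mul _)

/-- Weak convergence together with uniformly small tails gives trace-norm convergence. -/
lemma tnConv_of_tight {T : ℕ → H →L[ℂ] H} {L : H →L[ℂ] H} {M : ℝ} (hT : ∀ n, IsPTC (T n))
    (hL : IsPTC L) (hTM : ∀ n, (trC e (T n)).re ≤ M) (hLM : (trC e L).re ≤ M)
    (hw : ∀ x y, Tendsto (fun n => ⟪x, T n y⟫) atTop (𝓝 ⟪x, L y⟫))
    (htight : ∀ ε > 0, ∃ P, IsFinRankProj P ∧ (∀ n, (trC e ((1 - P) ∘L T n)).re ≤ ε) ∧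
      (trC e ((1 - P) ∘L L)).re ≤ ε) : TNConv e T L := by
  have hM : 0 ≤ M := (Complex.le_def.1 (hL.trC_nonneg (e := e))).1.trans hLM
  rw [TNConv, Metric.tendsto_nhds]
  intro δ hδ
  set t : ℝ := δ / (8 * (M + 1)) with ht
  have ht0 : 0 < t := by positivity
  have htM : t * M ≤ δ / 8 := by
    rw [ht, div_mul_eq_mul_div, div_le_div_iff₀ (by positivity) (by positivity)]
    nlinarith
  obtain ⟨P, hP, h1, h2⟩ := htight (t * (δ / 8)) (by positivity)
  obtain ⟨r, p, hp⟩ := hP.exists_expansion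
  have hlim : Tendsto (fun n => ∑ i, ∑ j, ‖p i‖ * ‖p j‖ * ‖⟪p j, (T n - L) (p i)⟫‖) atTop
      (𝓝 0) := by
    have : ∀ i j, Tendsto (fun n => ‖p i‖ * ‖p j‖ * ‖⟪p j, (T n - L) (p i)⟫‖) atTop (𝓝 0) := by
      intro i j
      have h3 := ((hw (p j) (p i)).sub_const ⟪p j, L (p i)⟫).norm.const_mul (‖p i‖ * ‖p j‖)
      simpa only [sub_self, norm_zero, mul_zero, sub_apply, inner_sub_right] using h3
    simpa using tendsto_finsetSum Finset.univ fun i _ =>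
      tendsto_finsetSum Finset.univ fun j _ => this i j
  have key : ∀ S, IsPTC S → (trC e S).re ≤ M → (trC e ((1 - P) ∘L S)).re ≤ t * (δ / 8) →
      ∀ B : H →L[ℂ] H, ‖B‖ ≤ 1 →
        ‖trC e (B ∘L S) - trC e ((P ∘L B ∘L P) ∘L S)‖ ≤ δ / 4 := by
    intro S hS hSM hSP B hB
    refine (hS.norm_trC_sub_compression_le hP hB ht0).trans ?_
    have h5 : (trC e ((1 - P) ∘L S)).re / t ≤ δ / 8 := by
      rw [div_le_iff₀ ht0]; linarith
    have h6 : t * (trC e S).re ≤ t * M := by gcongr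
    linarith
  filter_upwards [Metric.tendsto_nhds.1 hlim (δ / 4) (by positivity)] with n hn
  rw [Real.dist_0_eq_abs] at hn ⊢
  rw [abs_of_nonneg (tnorm_nonneg e _)]
  refine lt_of_le_of_lt (tnorm_le e (C := δ * 3 / 4) fun B hB => ?_) (by linarith)
  have hTL := (hT n).2.sub hL.2
  have k1 := key _ (hT n) (hTM n) (h1 n) B hB
  have k2 := key _ hL hLM h2 B hB
  have k3 := (trC_compression_le (e := e) hTL hp hB).trans ((le_abs_self _).trans hn.le)
  rw [comp_sub, ((hT n).2.comp_left B).trC_sub e (hL.2.comp_left B)]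
  rw [comp_sub, ((hT n).2.comp_left _).trC_sub e (hL.2.comp_left _)] at k3
  set a := trC e (B ∘L T n)
  set a' := trC e ((P ∘L B ∘L P) ∘L T n)
  set b := trC e (B ∘L L)
  set b' := trC e ((P ∘L B ∘L P) ∘L L)
  calc ‖a - b‖ = ‖(a - a') - (b - b') + (a' - b')‖ := by congr 1; ring
    _ ≤ ‖(a - a') - (b - b')‖ + ‖a' - b'‖ := norm_add_le _ _
    _ ≤ ‖a - a'‖ + ‖b - b'‖ + ‖a' - b'‖ := by gcongr; exact norm_sub_le _ _
    _ ≤ δ * 3 / 4 := by linarith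

end Projections

section Dual

variable {H K : Type*} [NormedAddCommGroup H] [InnerProductSpace ℂ H]
  [NormedAddCommGroup K] [InnerProductSpace ℂ K]
  {eA : HilbertBasis ℕ ℂ H} {eB : HilbertBasis ℕ ℂ K}

lemma IsPTC.norm_trC_comp_le [CompleteSpace H] {T : H →L[ℂ] H} (hT : IsPTC T) (B : H →L[ℂ] H) :
    ‖trC eA (B ∘L T)‖ ≤ ‖B‖ * (trC eA T).re := by
  obtain ⟨c, hc⟩ := hT.exists_posRep eA
  rw [← ((hc.comp_left B).trace eA).2.tsum_eq]
  refine tsum_of_norm_bounded ((Complex.hasSum_re (hc.trace eA).2).mul_left _) fun n => ?_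
  have hself : (⟪c n, c n⟫).re = ‖c n‖ ^ 2 := inner_self_eq_norm_sq (𝕜 := ℂ) (c n)
  rw [hself]
  calc _ ≤ ‖c n‖ * (‖B‖ * ‖c n‖) :=
        (norm_inner_le_norm _ _).trans (by gcongr; exact B.le_opNorm _)
    _ = _ := by ring

lemma QOp.isPTC_rankOne_self (Φ : QOp eA eB) (y : H) : IsPTC (Φ.toFun (rankOne y y)) :=
  ⟨isPositive_of_inner_nonneg fun x => by
    simpa using Φ.completely_pos' 1 (fun _ => y) (fun _ => x), Φ.maps_tc' _ (.rankOne y y)⟩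

lemma QOp.trC_rankOne_self_le (Φ : QOp eA eB) (y : H) :
    (trC eB (Φ.toFun (rankOne y y))).re ≤ ‖y‖ ^ 2 := by
  refine (Φ.trace_nonincreasing' _ (_root_.isPTC_rankOne_self y).1 (.rankOne y y)).trans_eq ?_
  rw [trC_rankOne]; exact inner_self_eq_norm_sq (𝕜 := ℂ) y

/-- `D` is the dual map of `Φ`. -/
def IsDual (Φ : QOp eA eB) (D : (K →L[ℂ] K) → (H →L[ℂ] H)) : Prop :=
  ∀ (B : K →L[ℂ] K) (ρ : H →L[ℂ] H), IsTC ρ → trC eB (Φ.toFun ρ ∘L B) = trC eA (D B ∘L ρ)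

namespace IsDual

variable {Φ : QOp eA eB} {D : (K →L[ℂ] K) → (H →L[ℂ] H)}

variable [CompleteSpace K]

lemma trC_comp (h : IsDual Φ D) {ρ : H →L[ℂ] H} (hρ : IsTC ρ) (B : K →L[ℂ] K) :
    trC eB (B ∘L Φ.toFun ρ) = trC eA (D B ∘L ρ) := by
  rw [(Φ.maps_tc' ρ hρ).trC_comm]; exact h B ρ hρ

lemma trC_toFun (h : IsDual Φ D) {ρ : H →L[ℂ] H} (hρ : IsTC ρ) :
    trC eB (Φ.toFun ρ) = trC eA (D 1 ∘L ρ) := by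
  rw [← h.trC_comp hρ]; rfl

lemma inner_toFun (h : IsDual Φ D) {ρ : H →L[ℂ] H} (hρ : IsTC ρ) (x y : K) :
    ⟪x, Φ.toFun ρ y⟫ = trC eA (D (rankOne y x) ∘L ρ) := by
  rw [← h.trC_comp hρ, (Φ.maps_tc' ρ hρ).trC_rankOne_comp]

lemma inner_apply (h : IsDual Φ D) (B : K →L[ℂ] K) (x y : H) :
    ⟪x, D B y⟫ = trC eB (B ∘L Φ.toFun (rankOne y x)) := by
  rw [h.trC_comp (.rankOne y x), trC_comp_rankOne]

lemma map_sub (h : IsDual Φ D) (B C : K →L[ℂ] K) : D (B - C) = D B - D C := by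
  ext y
  refine ext_inner_left ℂ fun x => ?_
  have ht := Φ.maps_tc' _ (.rankOne y x)
  rw [sub_apply, inner_sub_right, h.inner_apply, h.inner_apply, h.inner_apply, sub_comp,
    (ht.comp_left B).trC_sub eB (ht.comp_left C)]

lemma isPositive (h : IsDual Φ D) {B : K →L[ℂ] K} (hB : B.IsPositive) : (D B).IsPositive :=
  isPositive_of_inner_nonneg fun x => by
    rw [h.inner_apply]; exact (Φ.isPTC_rankOne_self x).trC_comp_nonneg hB

lemma isPositive_one_sub (h : IsDual Φ D) : (1 - D 1).IsPositive :=
  isPositive_of_inner_nonneg fun x => by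
    have h1 := Complex.le_def.1 ((Φ.isPTC_rankOne_self x).trC_nonneg (e := eB))
    have h2 := Complex.le_def.1 (zero_le_inner_self x)
    have h3 := Φ.trC_rankOne_self_le x
    have h4 : (⟪x, x⟫).re = ‖x‖ ^ 2 := inner_self_eq_norm_sq (𝕜 := ℂ) x
    have h5 : ⟪x, D 1 x⟫ = trC eB (Φ.toFun (rankOne x x)) := h.inner_apply 1 x x
    rw [sub_apply, inner_sub_right, one_apply_eq_self, h5, Complex.le_def]
    refine ⟨?_, ?_⟩
    · rw [Complex.sub_re, h4, Complex.zero_re]; linarith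
    · rw [Complex.sub_im, ← h1.2, ← h2.2]; simp

lemma norm_le_one [CompleteSpace H] (h : IsDual Φ D) {B : K →L[ℂ] K} (hB : B.IsPositive)
    (hB1 : (1 - B).IsPositive) : ‖D B‖ ≤ 1 := by
  refine norm_le_one_of_isPositive (h.isPositive hB) ?_
  have : 1 - D B = (1 - D 1) + D (1 - B) := by rw [h.map_sub]; abel
  rw [this]
  exact h.isPositive_one_sub.add (h.isPositive hB1)

lemma norm_le (h : IsDual Φ D) (B : K →L[ℂ] K) : ‖D B‖ ≤ 2 * ‖B‖ :=
  opNorm_le_of_inner_self (norm_nonneg B) fun x => by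
    rw [h.inner_apply]
    refine ((Φ.isPTC_rankOne_self x).norm_trC_comp_le B).trans ?_
    gcongr
    exact Φ.trC_rankOne_self_le x

lemma isPTC [CompleteSpace H] (h : IsDual Φ D) {ρ : H →L[ℂ] H} (hρ : IsPTC ρ) : IsPTC (Φ.toFun ρ) :=
  ⟨isPositive_of_inner_nonneg fun x => by
    rw [h.inner_toFun hρ.2]
    exact hρ.trC_comp_nonneg (h.isPositive (_root_.isPTC_rankOne_self x).1), Φ.maps_tc' ρ hρ.2⟩

lemma norm_toFun_le [CompleteSpace H] (h : IsDual Φ D) {ρ : H →L[ℂ] H} (hρ : IsTC ρ) {C : ℝ}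
    (hC : 0 ≤ C) (hC' : ∀ B : H →L[ℂ] H, ‖trC eA (B ∘L ρ)‖ ≤ ‖B‖ * C) : ‖Φ.toFun ρ‖ ≤ 2 * C := by
  refine ContinuousLinearMap.opNorm_le_bound _ (by positivity) fun y => ?_
  rcases eq_or_ne (Φ.toFun ρ y) 0 with h0 | h0
  · rw [h0, norm_zero]; positivity
  have hn : 0 < ‖Φ.toFun ρ y‖ := norm_pos_iff.2 h0
  refine le_of_mul_le_mul_right ?_ hn
  calc ‖Φ.toFun ρ y‖ * ‖Φ.toFun ρ y‖ = ‖⟪Φ.toFun ρ y, Φ.toFun ρ y⟫‖ := by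
        rw [inner_self_eq_norm_sq_to_K, norm_pow, RCLike.norm_ofReal, abs_norm, sq]
    _ ≤ 2 * (‖y‖ * ‖Φ.toFun ρ y‖) * C := by
        rw [h.inner_toFun hρ]
        refine (hC' _).trans ?_
        gcongr
        exact (h.norm_le _).trans (by gcongr; exact norm_rankOne_le _ _)
    _ = _ := by ring

lemma eq_one (h : IsDual Φ D) (hΦ : IsChannel Φ) : D 1 = 1 := by
  have key : ∀ x, ⟪x, (1 - D 1) x⟫ = 0 := fun x => by
    have h5 : ⟪x, D 1 x⟫ = trC eB (Φ.toFun (rankOne x x)) := h.inner_apply 1 x x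
    rw [sub_apply, inner_sub_right, one_apply_eq_self, h5,
      hΦ _ (_root_.isPTC_rankOne_self x).1 (.rankOne x x), trC_rankOne, sub_self]
  have := opNorm_le_of_inner_self (T := 1 - D 1) le_rfl fun x => by
    rw [key, norm_zero, zero_mul]
  rw [mul_zero, norm_le_zero_iff, sub_eq_zero] at this
  exact this.symm

lemma tail_eq {Φ : QOp eA eB} {D : (K →L[ℂ] K) → (H →L[ℂ] H)} (h : IsDual Φ D)
    {ρ : H →L[ℂ] H} (hρ : IsTC ρ) (P : K →L[ℂ] K) :
    trC eB ((1 - P) ∘L Φ.toFun ρ) = trC eA (D 1 ∘L ρ) - trC eA (D P ∘L ρ) := by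
  rw [h.trC_comp hρ, h.map_sub, sub_comp, (hρ.comp_left _).trC_sub eA (hρ.comp_left _)]

end IsDual

end Dual

section Limits

variable {H K : Type*} [NormedAddCommGroup H] [InnerProductSpace ℂ H] [CompleteSpace H]
  [NormedAddCommGroup K] [InnerProductSpace ℂ K] [CompleteSpace K]
  {eA : HilbertBasis ℕ ℂ H} {eB : HilbertBasis ℕ ℂ K}

/-- A weak limit of positive trace-class operators with bounded traces is trace class. -/
lemma isPTC_of_tendsto_inner {T : ℕ → H →L[ℂ] H} {A : H →L[ℂ] H} {M : ℝ}
    (hT : ∀ i, IsPTC (T i)) (hM : ∀ i, (trC eA (T i)).re ≤ M)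
    (hA : ∀ x y, Tendsto (fun i => ⟪x, T i y⟫) atTop (𝓝 ⟪x, A y⟫)) :
    IsPTC A ∧ (trC eA A).re ≤ M := by
  have hpos := isPositive_of_tendsto_inner (fun i => (hT i).1) hA
  have hre : ∀ {S : H →L[ℂ] H}, S.IsPositive → ∀ i, 0 ≤ (⟪eA i, S (eA i)⟫).re := fun hS i =>
    (Complex.le_def.1 (hS.inner_nonneg_right (eA i))).1
  have hb : ∀ s : Finset ℕ, ∑ i ∈ s, (⟪eA i, A (eA i)⟫).re ≤ M := fun s =>
    le_of_tendsto' (tendsto_finsetSum s fun i _ =>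
      (Complex.continuous_re.tendsto _).comp (hA (eA i) (eA i))) fun n =>
        (sum_le_hasSum s (fun i _ => hre (hT n).1 i)
          (Complex.hasSum_re ((hT n).2.summable_diag eA).hasSum)).trans (hM n)
  obtain ⟨c, hc⟩ := exists_posRep eA hpos (summable_of_sum_le (hre hpos) hb)
  exact ⟨⟨hpos, hc.isTC⟩, hasSum_le_of_sum_le
    (Complex.hasSum_re (hc.isTC.summable_diag eA).hasSum) hb⟩

/-- A pointwise weak limit of quantum operations is a quantum operation. -/
lemma exists_weak_limit_op {Ψ : ℕ → QOp eA eB} {D : ℕ → (K →L[ℂ] K) → (H →L[ℂ] H)}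
    (h : ∀ j, IsDual (Ψ j) (D j))
    (hw : ∀ ρ, IsTC ρ → ∃ L : K →L[ℂ] K, ∀ x y,
      Tendsto (fun j => ⟪x, (Ψ j).toFun ρ y⟫) atTop (𝓝 ⟪x, L y⟫)) :
    ∃ Φ₀ : QOp eA eB, ∀ ρ, IsTC ρ → ∀ x y,
      Tendsto (fun j => ⟪x, (Ψ j).toFun ρ y⟫) atTop (𝓝 ⟪x, Φ₀.toFun ρ y⟫) := by
  choose! L hL using hw
  have hadd : ∀ ρ τ, IsTC ρ → IsTC τ → L (ρ + τ) = L ρ + L τ := fun ρ τ hρ hτ =>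
    eq_of_tendsto_inner (hL _ (hρ.add hτ)) fun x y => by
      simpa only [(Ψ _).map_add' ρ τ hρ hτ, add_apply, inner_add_right] using
        (hL ρ hρ x y).add (hL τ hτ x y)
  have hsmul : ∀ (c : ℂ) ρ, IsTC ρ → L (c • ρ) = c • L ρ := fun c ρ hρ =>
    eq_of_tendsto_inner (hL _ (hρ.smul c)) fun x y => by
      simpa only [(Ψ _).map_smul' c ρ hρ, smul_apply, inner_smul_right] using
        (hL ρ hρ x y).const_mul c
  have hptc : ∀ ρ, IsPTC ρ → IsPTC (L ρ) ∧ (trC eB (L ρ)).re ≤ (trC eA ρ).re := fun ρ hρ =>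
    isPTC_of_tendsto_inner (fun j => (h j).isPTC hρ)
      (fun j => (Ψ j).trace_nonincreasing' ρ hρ.1 hρ.2) (hL ρ hρ.2)
  refine ⟨⟨L, hadd, hsmul, fun ρ hρ => ?_, fun n y x => ?_,
    fun ρ hρ hρ' => (hptc ρ ⟨hρ, hρ'⟩).2⟩, hL⟩
  · obtain ⟨Q, hQ, rfl⟩ := hρ.exists_decomposition
    have h0 := (hQ 0).2
    have h1 := (hQ 1).2.smul Complex.I
    have h2 := (hQ 2).2.smul (-1)
    have h3 := (hQ 3).2.smul (-Complex.I)
    rw [hsmul _ _ (((h0.add h1).add h2).add h3), hadd _ _ ((h0.add h1).add h2) h3,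
      hadd _ _ (h0.add h1) h2, hadd _ _ h0 h1, hsmul _ _ (hQ 1).2, hsmul _ _ (hQ 2).2,
      hsmul _ _ (hQ 3).2]
    have hL' := fun l => (hptc (Q l) (hQ l)).1.2
    exact ((((hL' 0).add ((hL' 1).smul _)).add ((hL' 2).smul _)).add ((hL' 3).smul _)).smul _
  · exact ge_of_tendsto' (tendsto_finsetSum _ fun i _ => tendsto_finsetSum _ fun j _ =>
      hL (rankOne (y i) (y j)) (.rankOne _ _) (x i) (x j)) fun k =>
        (Ψ k).completely_pos' n y x

lemma IsDual.tail_nonneg {Φ : QOp eA eB} {D : (K →L[ℂ] K) → (H →L[ℂ] H)} (h : IsDual Φ D)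
    {ρ : H →L[ℂ] H} (hρ : IsPTC ρ) {P : K →L[ℂ] K} (hP : IsFinRankProj P) :
    0 ≤ (trC eB ((1 - P) ∘L Φ.toFun ρ)).re :=
  (Complex.le_def.1 ((h.isPTC hρ).trC_comp_nonneg hP.isPositive_compl)).1

lemma IsDual.tail_le_one {Φ : QOp eA eB} {D : (K →L[ℂ] K) → (H →L[ℂ] H)} (h : IsDual Φ D)
    {σ : H →L[ℂ] H} (hσ : IsState eA σ) {P : K →L[ℂ] K} (hP : IsFinRankProj P) :
    (trC eB ((1 - P) ∘L Φ.toFun σ)).re ≤ 1 := by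
  have hT := h.isPTC ⟨hσ.1, hσ.2.1⟩
  have h1 := Φ.trace_nonincreasing' σ hσ.1 hσ.2.1
  have h2 := (Complex.le_def.1 (hT.trC_comp_nonneg (e := eB) hP.isPositive)).1
  rw [hσ.2.2, Complex.one_re] at h1
  rw [h.tail_eq hσ.2.1, ← h.trC_toFun hσ.2.1, ← h.trC_comp hσ.2.1, Complex.sub_re]
  rw [Complex.zero_re] at h2
  linarith

lemma IsDual.tail_le_iSup {Ψ : ℕ → QOp eA eB} {D : ℕ → (K →L[ℂ] K) → (H →L[ℂ] H)}
    (h : ∀ j, IsDual (Ψ j) (D j)) {σ : H →L[ℂ] H} (hσ : IsState eA σ) {P : K →L[ℂ] K}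
    (hP : IsFinRankProj P) (j : ℕ) : (trC eB ((1 - P) ∘L (Ψ j).toFun σ)).re ≤
      ⨆ j, (trC eB ((1 - P) ∘L (Ψ j).toFun σ)).re :=
  le_ciSup (f := fun j => (trC eB ((1 - P) ∘L (Ψ j).toFun σ)).re)
    ⟨1, by rintro _ ⟨j, rfl⟩; exact (h j).tail_le_one hσ hP⟩ j

/-- If the tails vanish uniformly on a faithful state, they do so on every trace-class operator. -/
lemma eventually_tail_le {Ψ : ℕ → QOp eA eB} {D : ℕ → (K →L[ℂ] K) → (H →L[ℂ] H)}
    (h : ∀ j, IsDual (Ψ j) (D j)) {σ : H →L[ℂ] H} (hσ : IsFaithfulState eA σ)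
    {P : ℕ → K →L[ℂ] K} (hP : ProjSeq P)
    (ht : Tendsto (fun m => ⨆ j, (trC eB ((1 - P m) ∘L (Ψ j).toFun σ)).re) atTop (𝓝 0))
    {ρ : H →L[ℂ] H} (hρ : IsTC ρ) {ε : ℝ} (hε : 0 < ε) :
    ∀ᶠ m in atTop, ∀ j, (trC eB ((1 - P m) ∘L (Ψ j).toFun ρ)).re ≤ ε := by
  have hsq : Tendsto (fun p : ℕ × ℕ => (trC eA (D p.2 (1 - P p.1) ∘L σ)).re)
      (atTop ×ˢ 𝓟 Set.univ) (𝓝 0) := by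
    simp only [← (h _).trC_comp hσ.1.2.1]
    exact squeeze_zero (fun p => (h p.2).tail_nonneg ⟨hσ.1.1, hσ.1.2.1⟩ (hP.1 p.1))
      (fun p => IsDual.tail_le_iSup h hσ.1 (hP.1 p.1) p.2)
      (ht.comp (tendsto_fst (g := 𝓟 (Set.univ : Set ℕ))))
  have hc : ∀ m, (1 - (1 - P m)).IsPositive := fun m => by
    rw [sub_sub_cancel]; exact (hP.1 m).isPositive
  have key := hσ.tendsto_trC_zero (D := fun p : ℕ × ℕ => D p.2 (1 - P p.1))
    (fun p => (h p.2).isPositive (hP.1 p.1).isPositive_compl)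
    (fun p => (h p.2).norm_le_one (hP.1 p.1).isPositive_compl (hc p.1)) hsq hρ
  have hev : ∀ᶠ p in atTop ×ˢ 𝓟 (Set.univ : Set ℕ),
      (trC eA (D p.2 (1 - P p.1) ∘L ρ)).re ≤ ε := key.eventually (ge_mem_nhds hε)
  refine (eventually_prod_principal_iff.1 hev).mono fun m hm j => ?_
  rw [(h j).trC_comp hρ]
  exact hm j (Set.mem_univ j)

/-- Uniformly vanishing tails on a faithful state give a strongly convergent subsequence. -/
lemma exists_subseq_strongConv {Ψ : ℕ → QOp eA eB} {D : ℕ → (K →L[ℂ] K) → (H →L[ℂ] H)}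
    (h : ∀ j, IsDual (Ψ j) (D j)) {σ : H →L[ℂ] H} (hσ : IsFaithfulState eA σ)
    {P : ℕ → K →L[ℂ] K} (hP : ProjSeq P)
    (ht : Tendsto (fun m => ⨆ j, (trC eB ((1 - P m) ∘L (Ψ j).toFun σ)).re) atTop (𝓝 0)) :
    ∃ φ : ℕ → ℕ, StrictMono φ ∧ ∃ Φ₀ : QOp eA eB, StrongConv (fun j => Ψ (φ j)) Φ₀ := by
  have hbd : ∀ (p : ℕ × ℕ) j, ‖D j (rankOne (eB p.1) (eB p.2))‖ ≤ 2 := fun p j => by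
    refine ((h j).norm_le _).trans ?_
    have := norm_rankOne_le (eB p.1) (eB p.2)
    rw [eB.orthonormal.norm_eq_one, eB.orthonormal.norm_eq_one] at this
    linarith
  obtain ⟨φ, hφ, A, hA⟩ := exists_subseq_weak_limit eA hbd
  have hw : ∀ ρ, IsTC ρ → ∃ L : K →L[ℂ] K, ∀ x y,
      Tendsto (fun j => ⟪x, (Ψ (φ j)).toFun ρ y⟫) atTop (𝓝 ⟪x, L y⟫) := by
    intro ρ hρ
    obtain ⟨C, hC, hC'⟩ := hρ.exists_bound eA
    refine exists_weak_limit_of_basis eB (fun j => (h (φ j)).norm_toFun_le hρ hC hC')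
      fun p q => ⟨trC eA (A (q, p) ∘L ρ), ?_⟩
    simp only [(h _).inner_toFun hρ]
    exact hρ.tendsto_trC eA (fun j => hbd (q, p) (φ j)) (hA (q, p))
  obtain ⟨Φ₀, hΦ₀⟩ := exists_weak_limit_op (fun j => h (φ j)) hw
  refine ⟨φ, hφ, Φ₀, fun ρ hρ => ?_⟩
  have hρ' : IsPTC ρ := ⟨hρ.1, hρ.2.1⟩
  have htr : ∀ j, (trC eB ((Ψ (φ j)).toFun ρ)).re ≤ 1 := fun j => by
    simpa [hρ.2.2] using (Ψ (φ j)).trace_nonincreasing' ρ hρ.1 hρ.2.1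
  obtain ⟨hL, hLM⟩ := isPTC_of_tendsto_inner (fun j => (h (φ j)).isPTC hρ') htr (hΦ₀ ρ hρ.2.1)
  refine tnConv_of_tight (fun j => (h (φ j)).isPTC hρ') hL htr hLM (hΦ₀ ρ hρ.2.1) fun ε hε => ?_
  obtain ⟨m, hm1, hm2⟩ := ((eventually_tail_le h hσ hP ht hρ.2.1 hε).and
    ((hL.2.tendsto_tail (e := eB) hP).eventually (ge_mem_nhds hε))).exists
  exact ⟨P m, hP.1 m, fun j => hm1 (φ j), hm2⟩

lemma tendsto_iSup_zero {t : ℕ → ℕ → ℝ} (h0 : ∀ m j, 0 ≤ t m j)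
    (hanti : ∀ j, Antitone fun m => t m j) (hj : ∀ j, Tendsto (fun m => t m j) atTop (𝓝 0))
    (h : ∀ ε > 0, ∃ m, ∀ᶠ j in atTop, t m j ≤ ε) :
    Tendsto (fun m => ⨆ j, t m j) atTop (𝓝 0) := by
  rw [Metric.tendsto_nhds]
  intro ε hε
  obtain ⟨m₀, hm₀⟩ := h (ε / 2) (by positivity)
  obtain ⟨j₀, hj₀⟩ := eventually_atTop.1 hm₀
  filter_upwards [eventually_ge_atTop m₀, (Finset.range j₀).eventually_all.2 fun j _ =>
    (hj j).eventually (ge_mem_nhds (half_pos hε))] with m hm hfin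
  rw [Real.dist_0_eq_abs, abs_of_nonneg (Real.iSup_nonneg fun j => h0 m j)]
  refine (ciSup_le fun j => ?_).trans_lt (half_lt_self hε)
  rcases lt_or_ge j j₀ with hlt | hge
  · exact hfin j (Finset.mem_range.2 hlt)
  · exact (hanti j hm).trans (hj₀ j hge)

/-- The tails vanish uniformly once they are small for all large indices. -/
lemma tendsto_iSup_tail {Ψ : ℕ → QOp eA eB} {D : ℕ → (K →L[ℂ] K) → (H →L[ℂ] H)}
    (h : ∀ j, IsDual (Ψ j) (D j)) {σ : H →L[ℂ] H} (hσ : IsPTC σ)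
    {P : ℕ → K →L[ℂ] K} (hP : ProjSeq P)
    (ht : ∀ ε > 0, ∃ m, ∀ᶠ j in atTop, (trC eB ((1 - P m) ∘L (Ψ j).toFun σ)).re ≤ ε) :
    Tendsto (fun m => ⨆ j, (trC eB ((1 - P m) ∘L (Ψ j).toFun σ)).re) atTop (𝓝 0) := by
  refine tendsto_iSup_zero (fun m j => (h j).tail_nonneg hσ (hP.1 m))
    (fun j => antitone_nat_of_succ_le fun m => ?_)
    (fun j => ((h j).isPTC hσ).2.tendsto_tail hP) ht
  have h1 := (Complex.le_def.1
    (((h j).isPTC hσ).trC_comp_nonneg (e := eB) (hP.isPositive_sub m))).1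
  rw [sub_comp, (((h j).isPTC hσ).2.comp_left _).trC_sub eB
    (((h j).isPTC hσ).2.comp_left _), Complex.sub_re, Complex.zero_re] at h1
  rw [(h j).tail_eq hσ.2, (h j).tail_eq hσ.2, ← (h j).trC_comp hσ.2 (P m),
    ← (h j).trC_comp hσ.2 (P (m + 1)), Complex.sub_re, Complex.sub_re]
  linarith

end Limits

section Criteria

variable {H K : Type*} [NormedAddCommGroup H] [InnerProductSpace ℂ H]
  [NormedAddCommGroup K] [InnerProductSpace ℂ K]
  {eA : HilbertBasis ℕ ℂ H} {eB : HilbertBasis ℕ ℂ K}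

lemma TNConv.tendsto_inner [CompleteSpace K] {a : ℕ → K →L[ℂ] K} {L : K →L[ℂ] K} (h : TNConv eB a L)
    (ha : ∀ n, IsTC (a n)) (hL : IsTC L) (x y : K) :
    Tendsto (fun n => ⟪x, a n y⟫) atTop (𝓝 ⟪x, L y⟫) := by
  simpa only [(ha _).trC_rankOne_comp, hL.trC_rankOne_comp] using
    h.tendsto_trC eB ha hL (rankOne y x)

variable {Φn : ℕ → QOp eA eB} {Φd : ℕ → (K →L[ℂ] K) → (H →L[ℂ] H)}

lemma hasImageLimitPointCh_iff (hch : ∀ n, IsChannel (Φn n)) :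
    HasImageLimitPointCh eA eB Φn ↔ HasImageLimitPoint eA eB Φn := by
  refine ⟨fun ⟨σ, hσ, k, L, hk, hL, hc⟩ => ⟨σ, hσ, k, L, hk, ⟨hL.1, hL.2.1⟩, hc⟩,
    fun ⟨σ, hσ, k, L, hk, hL, hc⟩ => ⟨σ, hσ, k, L, hk, ⟨hL.1, hL.2, ?_⟩, hc⟩⟩
  have := hc.tendsto_trC_one eB (fun j => (Φn (k j)).maps_tc' σ hσ.1.2.1) hL.2
  simp only [hch _ σ hσ.1.1 hσ.1.2.1, hσ.1.2.2] at this
  exact tendsto_nhds_unique this tendsto_const_nhds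

lemma dualScalarConditionCh_iff [CompleteSpace K] (hch : ∀ n, IsChannel (Φn n))
    (h : ∀ n, IsDual (Φn n) (Φd n)) :
    DualScalarConditionCh eA Φd ↔ DualScalarCondition eA Φd := by
  have h1 : ∀ n σ, IsState eA σ → (trC eA (Φd n 1 ∘L σ)).re = 1 := fun n σ hσ => by
    rw [← (h n).trC_toFun hσ.2.1, hch n σ hσ.1 hσ.2.1, hσ.2.2, Complex.one_re]
  refine ⟨fun ⟨σ, hσ, P, hP, k, hk, a, ha, hc, hs⟩ => ⟨σ, hσ, P, hP, k, hk, a, ha, hc, ?_⟩,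
    fun ⟨σ, hσ, P, hP, k, hk, a, ha, hc, hs⟩ => ⟨σ, hσ, P, hP, k, hk, a, ha, hc, ?_⟩⟩
  · simp only [h1 _ σ hσ.1, hs]; exact tendsto_const_nhds
  · simp only [h1 _ σ hσ.1] at hs
    exact tendsto_nhds_unique hs tendsto_const_nhds

lemma dualWOTConditionCh_iff [CompleteSpace K] (hch : ∀ n, IsChannel (Φn n))
    (h : ∀ n, IsDual (Φn n) (Φd n)) :
    DualWOTConditionCh Φd ↔ DualWOTCondition Φd := by
  have h1 := fun n => (h n).eq_one (hch n)
  refine ⟨fun ⟨P, hP, k, hk, A, hA, hc, hS⟩ => ⟨P, hP, k, hk, A, hA, hc, 1, hS, fun x y => ?_⟩,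
    fun ⟨P, hP, k, hk, A, hA, hc, S, hS, hc1⟩ => ⟨P, hP, k, hk, A, hA, hc, ?_⟩⟩
  · simp only [h1]; exact tendsto_const_nhds
  · rwa [eq_of_tendsto_inner (A := 1) (B := S) (fun x y => ?_) hc1]
    simp only [h1]; exact tendsto_const_nhds

variable [CompleteSpace H]

/-- A strong limit of quantum channels is a quantum channel. -/
lemma StrongConv.isChannel {Ψ : ℕ → QOp eA eB} {Φ₀ : QOp eA eB} (hΨ : ∀ j, IsChannel (Ψ j))
    (h : StrongConv Ψ Φ₀) : IsChannel Φ₀ := by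
  have hstate : ∀ ρ, IsState eA ρ → trC eB (Φ₀.toFun ρ) = 1 := fun ρ hρ => by
    have := (h ρ hρ).tendsto_trC_one eB (fun j => (Ψ j).maps_tc' ρ hρ.2.1) (Φ₀.maps_tc' ρ hρ.2.1)
    simp only [hΨ _ ρ hρ.1 hρ.2.1, hρ.2.2] at this
    exact tendsto_nhds_unique this tendsto_const_nhds
  intro ρ hρ hρ'
  obtain ⟨σ, hσ⟩ := exists_faithfulState eA
  have hnn := Complex.le_def.1 (IsPTC.trC_nonneg (e := eA) ⟨hρ, hρ'⟩)
  set t : ℝ := (trC eA ρ).re with ht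
  have htr : trC eA ρ = t := Complex.ext rfl hnn.2.symm
  have ht0 : 0 ≤ t := hnn.1
  have hne : ((1 + t : ℝ) : ℂ) ≠ 0 := by
    rw [Ne, Complex.ofReal_eq_zero]; positivity
  have hst : IsState eA (((1 + t : ℝ) : ℂ)⁻¹ • (ρ + σ)) := by
    refine ⟨isPositive_of_inner_nonneg fun x => ?_, (hρ'.add hσ.1.2.1).smul _, ?_⟩
    · rw [smul_apply, inner_smul_right, ← Complex.ofReal_inv]
      exact mul_nonneg (Complex.zero_le_real.2 (by positivity))
        ((hρ.add hσ.1.1).inner_nonneg_right x)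
    · rw [trC_smul, hρ'.trC_add eA hσ.1.2.1, htr, hσ.1.2.2, add_comm (t : ℂ)]
      push_cast at hne ⊢
      exact inv_mul_cancel₀ hne
  have h1 := hstate _ hst
  rw [Φ₀.map_smul' _ _ (hρ'.add hσ.1.2.1), Φ₀.map_add' _ _ hρ' hσ.1.2.1, trC_smul,
    (Φ₀.maps_tc' _ hρ').trC_add eB (Φ₀.maps_tc' _ hσ.1.2.1), hstate σ hσ.1,
    inv_mul_eq_iff_eq_mul₀ hne] at h1
  rw [htr]
  push_cast at h1
  linear_combination h1

lemma hasLimitPointCh_iff (hch : ∀ n, IsChannel (Φn n)) :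
    HasLimitPointCh eA eB Φn ↔ HasLimitPoint eA eB Φn :=
  ⟨fun ⟨k, Φ₀, hk, _, hc⟩ => ⟨k, Φ₀, hk, hc⟩,
    fun ⟨k, Φ₀, hk, hc⟩ => ⟨k, Φ₀, hk, hc.isChannel fun j => hch (k j), hc⟩⟩

variable [CompleteSpace K]

/-- Along a bounded sequence with least upper bound `S`, the traces against a positive trace-class
operator converge to their supremum. -/
lemma IsLUBOp.iSup_trC {A : ℕ → H →L[ℂ] H} {S : H →L[ℂ] H} (hS : IsLUBOp A S)
    (hmono : Monotone A) {C : ℝ} (hA : ∀ m, ‖A m‖ ≤ C) {σ : H →L[ℂ] H} (hσ : IsPTC σ) :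
    ⨆ m, (trC eA (A m ∘L σ)).re = (trC eA (S ∘L σ)).re := by
  obtain ⟨φ, hφ, S', hS'⟩ := exists_subseq_weak_limit eA (κ := Unit) (T := fun _ => A)
    fun _ => hA
  have hlim := hS' ()
  have hsub : ∀ (B : H →L[ℂ] H) x y,
      Tendsto (fun n => ⟪x, (A (φ n) - B) y⟫) atTop (𝓝 ⟪x, (S' () - B) y⟫) := fun B x y => by
    simpa only [sub_apply, inner_sub_right] using (hlim x y).sub_const ⟪x, B y⟫
  have hsub' : ∀ x y,
      Tendsto (fun n => ⟪x, (S - A (φ n)) y⟫) atTop (𝓝 ⟪x, (S - S' ()) y⟫) := fun x y => by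
    simpa only [sub_apply, inner_sub_right] using (hlim x y).const_sub ⟪x, S y⟫
  have hle : S' () ≤ S :=
    (ContinuousLinearMap.le_def _ _).2 (isPositive_of_tendsto_inner (fun n => hS.1 (φ n)) hsub')
  have hge : S ≤ S' () := by
    refine (ContinuousLinearMap.le_def _ _).2
      (hS.2 _ fun m => isPositive_of_inner_nonneg fun x => ?_)
    refine ge_of_tendsto (hsub (A m) x x) ?_
    filter_upwards [hφ.tendsto_atTop.eventually_ge_atTop m] with n hn
    exact ((ContinuousLinearMap.le_def _ _).1 (hmono hn)).inner_nonneg_right x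
  have htr : ∀ {B C : H →L[ℂ] H}, B ≤ C → (trC eA (B ∘L σ)).re ≤ (trC eA (C ∘L σ)).re := by
    intro B C hBC
    have := (Complex.le_def.1
      (hσ.trC_comp_nonneg (e := eA) ((ContinuousLinearMap.le_def _ _).1 hBC))).1
    rw [sub_comp, (hσ.2.comp_left C).trC_sub eA (hσ.2.comp_left B), Complex.sub_re,
      Complex.zero_re] at this
    linarith
  have h1 := (Complex.continuous_re.tendsto _).comp
    (hσ.2.tendsto_trC eA (fun n => hA (φ n)) hlim)
  rw [le_antisymm hle hge] at h1
  have h2 := tendsto_atTop_ciSup (f := fun m => (trC eA (A m ∘L σ)).re)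
    (fun m n hmn => htr (hmono hmn))
    ⟨(trC eA (S ∘L σ)).re, by rintro _ ⟨m, rfl⟩; exact htr (hS.1 m)⟩
  exact tendsto_nhds_unique (h2.comp hφ.tendsto_atTop) h1

lemma HasLimitPoint.hasImageLimitPoint (h : ∀ n, IsDual (Φn n) (Φd n))
    (hl : HasLimitPoint eA eB Φn) : HasImageLimitPoint eA eB Φn := by
  obtain ⟨k, Φ₀, hk, hc⟩ := hl
  obtain ⟨σ, hσ⟩ := exists_faithfulState eA
  have hTC := Φ₀.maps_tc' σ hσ.1.2.1
  have hptc := fun j => (h (k j)).isPTC ⟨hσ.1.1, hσ.1.2.1⟩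
  exact ⟨σ, hσ, k, Φ₀.toFun σ, hk, ⟨isPositive_of_tendsto_inner (fun j => (hptc j).1)
    ((hc σ hσ.1).tendsto_inner (fun j => (hptc j).2) hTC), hTC⟩, hc σ hσ.1⟩

lemma HasImageLimitPoint.tailCondition (h : ∀ n, IsDual (Φn n) (Φd n))
    (hl : HasImageLimitPoint eA eB Φn) : TailCondition eA eB Φn := by
  obtain ⟨σ, hσ, k, L, hk, hL, hc⟩ := hl
  obtain ⟨P, hP⟩ := exists_projSeq eB
  have hσ' : IsPTC σ := ⟨hσ.1.1, hσ.1.2.1⟩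
  refine ⟨σ, hσ, k, hk, P, hP, tendsto_iSup_tail (fun j => h (k j)) hσ' hP fun ε hε => ?_⟩
  obtain ⟨m, hm⟩ := ((hL.2.tendsto_tail (e := eB) hP).eventually (gt_mem_nhds hε)).exists
  have := (Complex.continuous_re.tendsto _).comp
    (hc.tendsto_trC eB (fun j => ((h (k j)).isPTC hσ').2) hL.2 (1 - P m))
  exact ⟨m, this.eventually (ge_mem_nhds hm)⟩

lemma TailCondition.hasLimitPoint (h : ∀ n, IsDual (Φn n) (Φd n))
    (ht : TailCondition eA eB Φn) : HasLimitPoint eA eB Φn := by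
  obtain ⟨σ, hσ, k, hk, P, hP, ht⟩ := ht
  obtain ⟨φ, hφ, Φ₀, hΦ₀⟩ := exists_subseq_strongConv (fun j => h (k j)) hσ hP ht
  exact ⟨k ∘ φ, Φ₀, hk.comp hφ, hΦ₀⟩

lemma TailCondition.dualWOTCondition (h : ∀ n, IsDual (Φn n) (Φd n))
    (ht : TailCondition eA eB Φn) : DualWOTCondition Φd := by
  obtain ⟨σ, hσ, k, hk, P, hP, ht⟩ := ht
  have hproj : ∀ m, (1 - (1 - P m)).IsPositive := fun m => by
    rw [sub_sub_cancel]; exact (hP.1 m).isPositive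
  obtain ⟨φ, hφ, A, hA⟩ := exists_subseq_weak_limit eA (κ := Option ℕ) (C := 2)
    (T := fun o j => Φd (k j) (o.elim 1 P)) fun o j => by
      refine ((h (k j)).norm_le _).trans ?_
      have : ‖o.elim 1 P‖ ≤ 1 := by
        rcases o with _ | m
        · exact ContinuousLinearMap.norm_id_le
        · exact norm_le_one_of_isPositive (hP.1 m).isPositive (hP.1 m).isPositive_compl
      linarith
  have hS := hA none
  have hAm := fun m => hA (some m)
  simp only [Option.elim] at hS hAm
  have hdiff : ∀ m x y, Tendsto (fun j => ⟪x, Φd (k (φ j)) (1 - P m) y⟫) atTop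
      (𝓝 ⟪x, (A none - A (some m)) y⟫) := fun m x y => by
    simpa only [(h _).map_sub, sub_apply, inner_sub_right] using (hS x y).sub (hAm m x y)
  have hnorm : ∀ m j, ‖Φd (k (φ j)) (1 - P m)‖ ≤ 1 := fun m j =>
    (h _).norm_le_one (hP.1 m).isPositive_compl (hproj m)
  have hpos : ∀ m, (A none - A (some m)).IsPositive := fun m =>
    isPositive_of_tendsto_inner (fun j => (h _).isPositive (hP.1 m).isPositive_compl) (hdiff m)
  have hpos1 : ∀ m, (1 - (A none - A (some m))).IsPositive := fun m =>
    isPositive_of_tendsto_inner (T := fun j => 1 - Φd (k (φ j)) (1 - P m)) (fun j => by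
      have := (h (k (φ j))).isPositive_one_sub.add ((h (k (φ j))).isPositive (hP.1 m).isPositive)
      rw [(h _).map_sub]
      convert this using 1
      abel) fun x y => by
        simpa only [sub_apply, inner_sub_right] using
          (hdiff m x y).const_sub ⟪x, (1 : H →L[ℂ] H) y⟫
  have htr : Tendsto (fun m => (trC eA ((A none - A (some m)) ∘L σ)).re) atTop (𝓝 0) := by
    refine squeeze_zero (fun m => ?_) (fun m => ?_) ht
    · exact (Complex.le_def.1 (IsPTC.trC_comp_nonneg ⟨hσ.1.1, hσ.1.2.1⟩ (hpos m))).1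
    · refine le_of_tendsto' ((Complex.continuous_re.tendsto _).comp
        (hσ.1.2.1.tendsto_trC eA (hnorm m) (hdiff m))) fun j => ?_
      rw [Function.comp_apply, ← (h _).trC_comp hσ.1.2.1]
      exact IsDual.tail_le_iSup (fun j => h (k j)) hσ.1 (hP.1 m) (φ j)
  have hzero := hσ.tendsto_zero hpos (fun m => norm_le_one_of_isPositive (hpos m) (hpos1 m)) htr
  refine ⟨P, hP, k ∘ φ, hk.comp hφ, fun m => A (some m), fun m => isPositive_of_tendsto_inner
    (fun j => (h _).isPositive (hP.1 m).isPositive) (hAm m), hAm, A none,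
    ⟨hpos, fun C hC => isPositive_of_tendsto_inner (l := atTop) hC fun x y => ?_⟩, hS⟩
  have := (tendsto_const_nhds (x := x)).inner (𝕜 := ℂ) ((hzero y).const_add ((C - A none) y))
  simpa only [← add_apply, sub_add_sub_cancel, add_zero] using this

lemma DualWOTCondition.dualScalarCondition (h : ∀ n, IsDual (Φn n) (Φd n))
    (hd : DualWOTCondition Φd) : DualScalarCondition eA Φd := by
  obtain ⟨P, hP, k, hk, A, hApos, hA, S, hS, hAS⟩ := hd
  obtain ⟨σ, hσ⟩ := exists_faithfulState eA
  have hσ' : IsPTC σ := ⟨hσ.1.1, hσ.1.2.1⟩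
  have hnorm : ∀ m j, ‖Φd (k j) (P m)‖ ≤ 1 := fun m j =>
    (h _).norm_le_one (hP.1 m).isPositive (hP.1 m).isPositive_compl
  have hnorm1 : ∀ j, ‖Φd (k j) 1‖ ≤ 1 := fun j =>
    (h _).norm_le_one ContinuousLinearMap.isPositive_one (by simp)
  have hA1 : ∀ m, (1 - A m).IsPositive := fun m =>
    isPositive_of_tendsto_inner (T := fun j => 1 - Φd (k j) (P m)) (fun j => by
      have := (h (k j)).isPositive_one_sub.add
        ((h (k j)).isPositive (hP.1 m).isPositive_compl)
      rw [(h _).map_sub] at this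
      convert this using 1
      abel) fun x y => by
        simpa only [sub_apply, inner_sub_right] using
          (hA m x y).const_sub ⟪x, (1 : H →L[ℂ] H) y⟫
  have hmono : Monotone A := monotone_nat_of_le_succ fun m =>
    (ContinuousLinearMap.le_def _ _).2 (isPositive_of_tendsto_inner (l := atTop)
      (T := fun j => Φd (k j) (P (m + 1) - P m))
      (fun j => (h _).isPositive (hP.isPositive_sub m)) fun x y => by
        simpa only [(h _).map_sub, sub_apply, inner_sub_right] using
          (hA (m + 1) x y).sub (hA m x y))
  have hsup := hS.iSup_trC (eA := eA) hmono
    (fun m => norm_le_one_of_isPositive (hApos m) (hA1 m)) hσ'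
  refine ⟨σ, hσ, P, hP, k, hk, fun m => (trC eA (A m ∘L σ)).re,
    fun m => (Complex.le_def.1 (hσ'.trC_comp_nonneg (hApos m))).1, fun m => ?_, ?_⟩
  · exact (Complex.continuous_re.tendsto _).comp (hσ'.2.tendsto_trC eA (hnorm m) (hA m))
  · rw [hsup]
    exact (Complex.continuous_re.tendsto _).comp (hσ'.2.tendsto_trC eA hnorm1 hAS)

lemma DualScalarCondition.tailCondition (h : ∀ n, IsDual (Φn n) (Φd n))
    (hd : DualScalarCondition eA Φd) : TailCondition eA eB Φn := by
  obtain ⟨σ, hσ, P, hP, k, hk, a, -, ha, ha1⟩ := hd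
  refine ⟨σ, hσ, k, hk, P, hP, tendsto_iSup_tail (fun j => h (k j)) ⟨hσ.1.1, hσ.1.2.1⟩ hP
    fun ε hε => ?_⟩
  obtain ⟨m, hm⟩ := exists_lt_of_lt_ciSup (sub_lt_self (⨆ m, a m) hε)
  refine ⟨m, ?_⟩
  simp only [(h _).tail_eq hσ.1.2.1, Complex.sub_re]
  exact (ha1.sub (ha m)).eventually (ge_mem_nhds (by linarith))

end Criteria

/-- Criteria for the existence of a limit point of a sequence of quantum operations w.r.t.
the strong convergence: the conditions (i)–(v) are equivalent, and in the case of a sequence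
of quantum channels the corresponding channel versions are equivalent. -/
theorem limit_point_criteria
    (Φn : ℕ → QOp eA eB)
    (Φd : ℕ → (HB →L[ℂ] HB) → (HA →L[ℂ] HA))
    (hdual : ∀ (n : ℕ) (B : HB →L[ℂ] HB) (ρ : HA →L[ℂ] HA), IsTC ρ →
      trC eB ((Φn n).toFun ρ ∘L B) = trC eA (Φd n B ∘L ρ)) :
    (HasLimitPoint eA eB Φn ↔ HasImageLimitPoint eA eB Φn) ∧
    (HasImageLimitPoint eA eB Φn ↔ TailCondition eA eB Φn) ∧
    (TailCondition eA eB Φn ↔ DualWOTCondition Φd) ∧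
    (DualWOTCondition Φd ↔ DualScalarCondition eA Φd) ∧
    ((∀ n, IsChannel (Φn n)) →
      (HasLimitPointCh eA eB Φn ↔ HasImageLimitPointCh eA eB Φn) ∧
      (HasImageLimitPointCh eA eB Φn ↔ TailCondition eA eB Φn) ∧
      (TailCondition eA eB Φn ↔ DualWOTConditionCh Φd) ∧
      (DualWOTConditionCh Φd ↔ DualScalarConditionCh eA Φd)) := by
  have h : ∀ n, IsDual (Φn n) (Φd n) := hdual
  have h12 : HasLimitPoint eA eB Φn → HasImageLimitPoint eA eB Φn :=
    HasLimitPoint.hasImageLimitPoint h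
  have h23 : HasImageLimitPoint eA eB Φn → TailCondition eA eB Φn :=
    HasImageLimitPoint.tailCondition h
  have h31 : TailCondition eA eB Φn → HasLimitPoint eA eB Φn := TailCondition.hasLimitPoint h
  have h34 : TailCondition eA eB Φn → DualWOTCondition Φd := TailCondition.dualWOTCondition h
  have h45 : DualWOTCondition Φd → DualScalarCondition eA Φd :=
    DualWOTCondition.dualScalarCondition h
  have h53 : DualScalarCondition eA Φd → TailCondition eA eB Φn :=
    DualScalarCondition.tailCondition h
  have e12 : HasLimitPoint eA eB Φn ↔ HasImageLimitPoint eA eB Φn := ⟨h12, h31 ∘ h23⟩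
  have e23 : HasImageLimitPoint eA eB Φn ↔ TailCondition eA eB Φn := ⟨h23, h12 ∘ h31⟩
  have e34 : TailCondition eA eB Φn ↔ DualWOTCondition Φd := ⟨h34, h53 ∘ h45⟩
  have e45 : DualWOTCondition Φd ↔ DualScalarCondition eA Φd := ⟨h45, h34 ∘ h53⟩
  refine ⟨e12, e23, e34, e45, fun hch => ?_⟩
  rw [hasLimitPointCh_iff hch, hasImageLimitPointCh_iff hch, dualWOTConditionCh_iff hch h,
    dualScalarConditionCh_iff hch h]
  exact ⟨e12, e23, e34, e45⟩

end Statement
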